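/- arXiv:2401.12620 — 6 statements merged into one kernel-verified Lean document; each statement's English description precedes it below -/
import Mathlib

section
/- Let g ∈ ℤ[X] be a monic polynomial with g(0) = 1 or g(0) = −1, and set f := g·g*. Then deg f is even, |f(1)| = g(1)², |f(−1)| = g(−1)², and (−1)^(deg f/2)·f(1)·f(−1) = (g(1)·g(−1))². In particular, f satisfies condition (Square). -/
open Polynomial

/-- For a monic polynomial `g ∈ ℤ[X]` with `g(0) = ±1`, the polynomial
`g*(X) = g(0)⁻¹ · X^(deg g) · g(1/X)`; since `g(0)⁻¹ = g(0)`, this is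
`g(0) · reverse g`. -/
noncomputable def starIntPoly (g : ℤ[X]) : ℤ[X] :=
  Polynomial.C (g.eval 0) * g.reverse

/-- Condition `(Square)` for a polynomial `f ∈ ℤ[X]` of even degree: `|f(1)|`, `|f(-1)|`
and `(-1)^(deg f/2)·f(1)·f(-1)` are all squares of integers. -/
def SquareCond (F : ℤ[X]) : Prop :=
  IsSquare |F.eval 1| ∧ IsSquare |F.eval (-1)| ∧
    IsSquare ((-1) ^ (F.natDegree / 2) * F.eval 1 * F.eval (-1))

/-- For a monic `g ∈ ℤ[X]` with `g(0) = ±1` and `f := g·g*`, the degree of `f` is even,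
`|f(1)| = g(1)²`, `|f(-1)| = g(-1)²`, and `(-1)^(deg f/2)·f(1)·f(-1) = (g(1)·g(-1))²`;
in particular `f` satisfies condition `(Square)`. -/
theorem squareCond_of_type_two (g : ℤ[X]) (hg : g.Monic)
    (h0 : g.eval 0 = 1 ∨ g.eval 0 = -1)
    (f : ℤ[X]) (hf : f = g * starIntPoly g) :
    Even f.natDegree ∧
    |f.eval 1| = (g.eval 1) ^ 2 ∧
    |f.eval (-1)| = (g.eval (-1)) ^ 2 ∧
    (-1) ^ (f.natDegree / 2) * f.eval 1 * f.eval (-1) = (g.eval 1 * g.eval (-1)) ^ 2 ∧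
    SquareCond f := by
  have hc : g.coeff 0 = g.eval 0 := coeff_zero_eq_eval_zero g
  have hne : g.eval 0 ≠ 0 := by rcases h0 with h | h <;> rw [h] <;> norm_num
  have hc2 : g.eval 0 * g.eval 0 = 1 := by rcases h0 with h | h <;> rw [h] <;> norm_num
  have hrev : g.reverse.natDegree = g.natDegree := by
    rw [reverse_natDegree, natTrailingDegree_eq_zero.mpr (Or.inr (by rw [hc]; exact hne))]
    simp
  have hr0 : g.reverse ≠ 0 := by
    rw [Ne, reverse_eq_zero]; exact hg.ne_zero
  have hdeg : f.natDegree = g.natDegree + g.natDegree := by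
    rw [hf, starIntPoly, natDegree_mul hg.ne_zero (mul_ne_zero (by simpa using hne) hr0),
      natDegree_C_mul hne, hrev]
  have h1 : g.reverse.eval 1 = g.eval 1 := by
    let _ : Invertible (1 : ℤ) := invertibleOne
    have h : g.reverse.eval 1 * 1 ^ g.natDegree = g.eval 1 :=
      eval₂_reverse_mul_pow (RingHom.id ℤ) (1 : ℤ) g
    simpa using h
  let _ : Invertible (-1 : ℤ) := ⟨-1, by norm_num, by norm_num⟩
  have hm : g.reverse.eval (-1) * (-1) ^ g.natDegree = g.eval (-1) :=
    eval₂_reverse_mul_pow (RingHom.id ℤ) (-1 : ℤ) g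
  have hs : ((-1 : ℤ) ^ g.natDegree) * (-1) ^ g.natDegree = 1 := by
    rw [← mul_pow]; norm_num
  have hf1 : f.eval 1 = g.eval 0 * g.eval 1 ^ 2 := by
    rw [hf, starIntPoly, eval_mul, eval_mul, eval_C, h1]; ring
  have hfm : f.eval (-1) = g.eval 0 * (-1) ^ g.natDegree * g.eval (-1) ^ 2 := by
    rw [hf, starIntPoly, eval_mul, eval_mul, eval_C]
    linear_combination (g.eval 0 * (-1) ^ g.natDegree * g.eval (-1)) * hm -
      g.eval (-1) * g.eval 0 * g.reverse.eval (-1) * hs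
  have ha : |g.eval 0| = 1 := by rcases h0 with h | h <;> rw [h] <;> norm_num
  have A1 : |f.eval 1| = (g.eval 1) ^ 2 := by
    rw [hf1, abs_mul, ha, one_mul, abs_of_nonneg (sq_nonneg _)]
  have A2 : |f.eval (-1)| = (g.eval (-1)) ^ 2 := by
    rw [hfm, abs_mul, abs_mul, ha, abs_pow, abs_neg, abs_one, one_pow, one_mul, one_mul,
      abs_of_nonneg (sq_nonneg _)]
  have A3 : (-1) ^ (f.natDegree / 2) * f.eval 1 * f.eval (-1)
      = (g.eval 1 * g.eval (-1)) ^ 2 := by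
    have hd : f.natDegree / 2 = g.natDegree := by omega
    rw [hd, hf1, hfm]
    linear_combination (g.eval 1 * g.eval (-1)) ^ 2 * (g.eval 0 * g.eval 0 * hs + hc2)
  exact ⟨⟨_, hdeg⟩, A1, A2, A3, ⟨_, A1.trans (sq _)⟩, ⟨_, A2.trans (sq _)⟩, ⟨_, A3.trans (sq _)⟩⟩
end

section
/- Let p be a prime and m ≥ 3 an integer with p ∤ m, and let f̄ be a monic irreducible factor of the image of the m-th cyclotomic polynomial Φ_m in 𝔽_p[X] (note f̄(0) ≠ 0, so f̄* is defined). Then f̄* = f̄ if and only if there exists an integer r ≥ 0 with p^r ≡ −1 (mod m). Consequently, either every monic irreducible factor of Φ_m mod p is *-symmetric, or none is. -/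
open Polynomial

/-- For a monic polynomial `F` over a field with `F 0 ≠ 0`, the normalized reversed
polynomial `F*(X) = F(0)⁻¹ · X^(deg F) · F(1/X)`. -/
noncomputable def starPoly {K : Type*} [Field K] (F : K[X]) : K[X] :=
  Polynomial.C (F.eval 0)⁻¹ * F.reverse

theorem star_key (p m : ℕ) [Fact p.Prime]
    (hm : 3 ≤ m) (hpm : ¬ p ∣ m)
    (f : Polynomial (ZMod p)) (hf : f.Monic) (hfirr : Irreducible f)
    (hfdvd : f ∣ (Polynomial.cyclotomic m ℤ).map (Int.castRingHom (ZMod p))) :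
    (starPoly f = f ↔ ∃ r : ℕ, (p : ZMod m) ^ r = -1) := by
  rw [map_cyclotomic_int] at hfdvd
  have hf0 : f.eval 0 ≠ 0 := by
    intro h
    obtain ⟨q, hq⟩ := hfdvd
    have h1 := cyclotomic_coeff_zero (ZMod p) (n := m) (by omega)
    rw [coeff_zero_eq_eval_zero, hq, eval_mul, h, zero_mul] at h1
    exact zero_ne_one h1
  have : Fact (Irreducible f) := ⟨hfirr⟩
  have : NeZero m := ⟨by omega⟩
  have : CharP (AdjoinRoot f) p := charP_of_injective_algebraMap' (ZMod p) p
  have : Module.Finite (ZMod p) (AdjoinRoot f) := hf.finite_adjoinRoot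
  have : Finite (AdjoinRoot f) := Module.finite_of_finite (ZMod p)
  set z : AdjoinRoot f := AdjoinRoot.root f with hz
  have hzr : aeval z f = 0 := by
    rw [aeval_def]; exact AdjoinRoot.eval₂_root f
  have : NeZero (m : AdjoinRoot f) := ⟨by
    rw [Ne, CharP.cast_eq_zero_iff (AdjoinRoot f) p]; exact hpm⟩
  have hprim : IsPrimitiveRoot z m := by
    rw [← isRoot_cyclotomic_iff]
    obtain ⟨q, hq⟩ := hfdvd
    have := congrArg (aeval z) hq
    rw [map_mul, hzr, zero_mul, aeval_def, ← eval_map, map_cyclotomic] at this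
    exact this
  have hz0 : z ≠ 0 := hprim.ne_zero (by omega)
  have hc : f.coeff 0 ≠ 0 := by rwa [coeff_zero_eq_eval_zero]
  have hdeg : f.reverse.natDegree = f.natDegree := by
    rw [reverse_natDegree, natTrailingDegree_eq_zero.2 (Or.inr hc), Nat.sub_zero]
  have hstar : starPoly f = f ↔ aeval z⁻¹ f = 0 := by
    have hrev : aeval z⁻¹ f.reverse = 0 := by
      letI := invertibleOfNonzero hz0
      have h := (eval₂_reverse_eq_zero_iff (algebraMap (ZMod p) (AdjoinRoot f)) z f).2
        (by rw [← aeval_def]; exact hzr)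
      rw [invOf_eq_inv] at h
      rw [aeval_def]; exact h
    constructor
    · intro h
      have h2 : aeval z⁻¹ (starPoly f) = 0 := by rw [starPoly, map_mul, hrev, mul_zero]
      exact (congrArg (aeval z⁻¹) h).symm.trans h2
    · intro h
      have hmin : f = minpoly (ZMod p) z⁻¹ := minpoly.eq_of_irreducible_of_monic hfirr h hf
      have hd : f ∣ starPoly f := by
        conv_lhs => rw [hmin]
        apply minpoly.dvd
        rw [starPoly, map_mul, hrev, mul_zero]
      have hmon : (starPoly f).Monic := by
        rw [starPoly, Monic, leadingCoeff_mul, leadingCoeff_C, reverse_leadingCoeff,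
          trailingCoeff, natTrailingDegree_eq_zero.2 (Or.inr hc), coeff_zero_eq_eval_zero]
        exact inv_mul_cancel₀ hf0
      refine (eq_of_monic_of_dvd_of_natDegree_le hf hmon hd ?_)
      rw [starPoly, natDegree_C_mul (inv_ne_zero hf0), hdeg]
  have hpow : ∀ r : ℕ, (p : ZMod m) ^ r = -1 ↔ z ^ p ^ r = z⁻¹ := by
    intro r
    rw [← mul_eq_one_iff_eq_inv₀ hz0, ← pow_succ, hprim.pow_eq_one_iff_dvd,
      ← ZMod.natCast_eq_zero_iff, eq_neg_iff_add_eq_zero]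
    push_cast
    rfl
  have hfrob : ∀ r : ℕ, ∀ x : AdjoinRoot f,
      ((FiniteField.frobeniusAlgHom (ZMod p) (AdjoinRoot f)) ^ r) x = x ^ p ^ r := by
    intro r x
    induction r with
    | zero => simp
    | succ n ih =>
      rw [pow_succ', AlgHom.mul_apply, ih, FiniteField.coe_frobeniusAlgHom]
      simp [ZMod.card, pow_succ, pow_mul]
  rw [hstar]
  simp_rw [hpow]
  constructor
  · intro h
    obtain ⟨n, hn⟩ := (FiniteField.bijective_frobeniusAlgHom_pow (ZMod p) (AdjoinRoot f)).2
      (AdjoinRoot.liftAlgHom f (Algebra.ofId _ _) z⁻¹ h)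
    refine ⟨n, ?_⟩
    rw [← hfrob]
    have := DFunLike.congr_fun hn z
    simpa [hz] using this
  · rintro ⟨r, hr⟩
    rw [← hr, ← hfrob, aeval_algHom_apply, hzr, map_zero]

/-- Let `p` be a prime and `m ≥ 3` with `p ∤ m`, and let `f̄` be a monic irreducible
factor of the image of `Φ_m` in `𝔽_p[X]`.  Then `f̄* = f̄` iff `p^r ≡ -1 (mod m)` for some
`r ≥ 0`; consequently either all monic irreducible factors of `Φ_m mod p` are
`*`-symmetric, or none is. -/
theorem starPoly_factor_cyclotomic_mod (p m : ℕ) [Fact p.Prime]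
    (hm : 3 ≤ m) (hpm : ¬ p ∣ m)
    (f : Polynomial (ZMod p)) (hf : f.Monic) (hfirr : Irreducible f)
    (hfdvd : f ∣ (Polynomial.cyclotomic m ℤ).map (Int.castRingHom (ZMod p)))
    (hf0 : f.eval 0 ≠ 0) :
    (starPoly f = f ↔ ∃ r : ℕ, (p : ZMod m) ^ r = -1) ∧
    ((∀ g : Polynomial (ZMod p), g.Monic → Irreducible g →
        g ∣ (Polynomial.cyclotomic m ℤ).map (Int.castRingHom (ZMod p)) →
        starPoly g = g) ∨
     (∀ g : Polynomial (ZMod p), g.Monic → Irreducible g →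
        g ∣ (Polynomial.cyclotomic m ℤ).map (Int.castRingHom (ZMod p)) →
        starPoly g ≠ g)) := by
  refine ⟨star_key p m hm hpm f hf hfirr hfdvd, ?_⟩
  by_cases h : ∃ r : ℕ, (p : ZMod m) ^ r = -1
  · exact Or.inl fun g hg hgi hgd => (star_key p m hm hpm g hg hgi hgd).2 h
  · exact Or.inr fun g hg hgi hgd hs => h ((star_key p m hm hpm g hg hgi hgd).1 hs)
end

section
/- Let n ≥ 3 be an integer and p a prime. Then the number of distinct monic irreducible factors of the n-th cyclotomic polynomial Φ_n in ℚ_p[X] equals the number of distinct monic irreducible factors of the image of Φ_n in 𝔽_p[X]. The same equality holds for the trace polynomial Ψ_n of Φ_n: the number of distinct monic irreducible factors of Ψ_n in ℚ_p[X] equals the number of distinct monic irreducible factors of the image of Ψ_n in 𝔽_p[X]. -/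
open Polynomial

theorem exists_residue_data (p : ℕ) [Fact p.Prime] :
    ∃ (κ : Type) (_ : Field κ) (V : Subring (PadicAlgCl p)) (r : V →+* κ)
      (j : ZMod p →+* κ) (φ : ℤ_[p] →+* V),
      (∀ x, (φ x : PadicAlgCl p) = algebraMap ℤ_[p] (PadicAlgCl p) x) ∧
      (∀ x : ℤ_[p], r (φ x) = j (PadicInt.toZMod x)) ∧
      (∀ x : PadicAlgCl p, IsIntegral ℤ_[p] x → x ∈ V) ∧
      (∀ σ : PadicAlgCl p ≃ₐ[ℚ_[p]] PadicAlgCl p, ∀ x y : V, (y : PadicAlgCl p) = σ x →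
        r x = 0 → r y = 0) := by
  let A : ValuationSubring (PadicAlgCl p) := (Valued.v : Valuation (PadicAlgCl p) NNReal).valuationSubring
  have hA : ∀ x, x ∈ A ↔ ‖x‖ ≤ 1 := fun x => Iff.rfl
  have hmem : ∀ x : ℤ_[p], algebraMap ℤ_[p] (PadicAlgCl p) x ∈ A.toSubring := by
    intro x
    rw [IsScalarTower.algebraMap_apply ℤ_[p] ℚ_[p] (PadicAlgCl p)]
    change _ ∈ A
    rw [hA, norm_algebraMap']
    exact x.2
  let φ : ℤ_[p] →+* A.toSubring := (algebraMap ℤ_[p] (PadicAlgCl p)).codRestrict A.toSubring hmem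
  let r : A.toSubring →+* IsLocalRing.ResidueField A := IsLocalRing.residue A
  have hr : ∀ x : A.toSubring, r x = 0 ↔ ‖(x : PadicAlgCl p)‖ < 1 := by
    intro x
    change IsLocalRing.residue A x = 0 ↔ _
    rw [IsLocalRing.residue_eq_zero_iff, IsLocalRing.mem_maximalIdeal, mem_nonunits_iff]
    have hx : ‖(x : PadicAlgCl p)‖ ≤ 1 := x.2
    constructor
    · intro h
      by_contra hlt
      have h1 : ‖(x : PadicAlgCl p)‖ = 1 := le_antisymm hx (not_lt.mp hlt)
      apply h
      have hx0 : (x : PadicAlgCl p) ≠ 0 := by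
        intro h0; rw [h0] at h1; simp at h1
      refine IsUnit.of_mul_eq_one (⟨(x : PadicAlgCl p)⁻¹, ?_⟩ : A) ?_
      · rw [hA, norm_inv, h1, inv_one]
      · exact Subtype.ext (mul_inv_cancel₀ hx0)
    · rintro hlt ⟨u, hu⟩
      have h1 : ((x : PadicAlgCl p)) * ((↑u⁻¹ : A) : PadicAlgCl p) = 1 := by
        have := congrArg (Subtype.val) (Units.mul_inv u)
        rw [hu] at this
        exact this
      have h2 : ‖((↑u⁻¹ : A) : PadicAlgCl p)‖ ≤ 1 := (↑u⁻¹ : A).2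
      have h3 := congrArg norm h1
      rw [norm_mul, norm_one] at h3
      nlinarith [norm_nonneg (x : PadicAlgCl p), norm_nonneg ((↑u⁻¹ : A) : PadicAlgCl p)]
  have hsurj : Function.Surjective (PadicInt.toZMod : ℤ_[p] →+* ZMod p) := ZMod.ringHom_surjective _
  have hker : RingHom.ker (PadicInt.toZMod : ℤ_[p] →+* ZMod p) ≤ RingHom.ker (r.comp φ) := by
    intro x hx
    rw [PadicInt.ker_toZMod, IsLocalRing.mem_maximalIdeal, PadicInt.mem_nonunits] at hx
    rw [RingHom.mem_ker, RingHom.comp_apply, hr]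
    change ‖algebraMap ℤ_[p] (PadicAlgCl p) x‖ < 1
    rw [IsScalarTower.algebraMap_apply ℤ_[p] ℚ_[p] (PadicAlgCl p), norm_algebraMap']
    exact hx
  refine ⟨IsLocalRing.ResidueField A, inferInstance, A.toSubring, r,
    RingHom.liftOfSurjective _ hsurj ⟨r.comp φ, hker⟩, φ, fun x => rfl, ?_, ?_, ?_⟩
  · intro x
    rw [RingHom.liftOfSurjective_comp_apply]; rfl
  · intro x hx
    obtain ⟨f, hf, hfx⟩ := hx
    have : IsIntegral A x := by
      refine ⟨f.map (φ : ℤ_[p] →+* A), hf.map _, ?_⟩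
      rw [eval₂_map]
      exact hfx
    obtain ⟨y, hy⟩ := IsIntegrallyClosed.isIntegral_iff.mp this
    rw [← hy]; exact y.2
  · intro σ x y hxy
    rw [hr, hr, hxy]
    intro h
    rwa [← PadicAlgCl.spectralNorm_eq, ← spectralNorm_eq_of_equiv, PadicAlgCl.spectralNorm_eq]

theorem ncard_image_eq {X A B : Type*} (S : Set X) (a : X → A) (b : X → B)
    (h : ∀ x ∈ S, ∀ y ∈ S, a x = a y ↔ b x = b y) : (a '' S).ncard = (b '' S).ncard := by
  refine Set.ncard_congr (fun _ hz => b hz.choose) ?_ ?_ ?_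
  · intro z hz
    exact ⟨hz.choose, hz.choose_spec.1, rfl⟩
  · intro z w hz hw hzw
    rw [← hz.choose_spec.2, ← hw.choose_spec.2]
    exact (h _ hz.choose_spec.1 _ hw.choose_spec.1).mpr hzw
  · rintro _ ⟨x, hx, rfl⟩
    have hz : a x ∈ a '' S := ⟨x, hx, rfl⟩
    exact ⟨a x, hz, (h _ hz.choose_spec.1 _ hx).mp hz.choose_spec.2⟩

theorem ncard_factors_padic_eq (p : ℕ) [Fact p.Prime] (F : ℤ_[p][X]) (hF : F.Monic)
    (hB : ∀ A B : ℤ_[p][X], A.Monic → B.Monic → A * B ∣ F →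
      IsCoprime (A.map PadicInt.toZMod) (B.map PadicInt.toZMod)) :
    {q : Polynomial ℚ_[p] | q.Monic ∧ Irreducible q ∧
        q ∣ F.map (algebraMap ℤ_[p] ℚ_[p])}.ncard =
      {q : Polynomial (ZMod p) | q.Monic ∧ Irreducible q ∧
        q ∣ F.map PadicInt.toZMod}.ncard := by
  obtain ⟨κ, _, V, r, j, φ, hφ, hrj, hintegral, hσ⟩ := exists_residue_data p
  let _ : Algebra (ZMod p) κ := j.toAlgebra
  have hjalg : algebraMap (ZMod p) κ = j := rfl
  have hφc : V.subtype.comp φ = algebraMap ℤ_[p] (PadicAlgCl p) := RingHom.ext hφ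
  have hrc : r.comp φ = j.comp PadicInt.toZMod := RingHom.ext hrj
  have ev1 : ∀ (f : ℤ_[p][X]) (x : V), ((eval₂ φ x f : V) : PadicAlgCl p) = aeval (x : PadicAlgCl p) f := by
    intro f x
    have := hom_eval₂ f φ V.subtype x
    rw [hφc] at this
    exact this
  have ev2 : ∀ (f : ℤ_[p][X]) (x : V), r (eval₂ φ x f) = aeval (r x) (f.map PadicInt.toZMod) := by
    intro f x
    rw [hom_eval₂, hrc, aeval_def, eval₂_map, hjalg]
  let S : Set V := {x | aeval (x : PadicAlgCl p) F = 0}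
  have hSint : ∀ x ∈ S, IsIntegral ℤ_[p] (x : PadicAlgCl p) := fun x hx => ⟨F, hF, hx⟩
  have hSr : ∀ x ∈ S, ∀ f : ℤ_[p][X], aeval (x : PadicAlgCl p) f = 0 →
      aeval (r x) (f.map PadicInt.toZMod) = 0 := by
    intro x hx f hf
    rw [← ev2]
    have : eval₂ φ x f = 0 := Subtype.ext (by rw [ev1, hf]; rfl)
    rw [this, map_zero]
  have hSrint : ∀ x ∈ S, IsIntegral (ZMod p) (r x) := fun x hx =>
    ⟨F.map PadicInt.toZMod, hF.map _, hSr x hx F hx⟩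
  have hA : {q : Polynomial ℚ_[p] | q.Monic ∧ Irreducible q ∧
        q ∣ F.map (algebraMap ℤ_[p] ℚ_[p])} = (fun x : V => minpoly ℚ_[p] (x : PadicAlgCl p)) '' S := by
    ext q
    constructor
    · rintro ⟨hq, hqi, hqd⟩
      obtain ⟨x, hx⟩ := IsAlgClosed.exists_aeval_eq_zero (PadicAlgCl p) q
        (degree_pos_of_irreducible hqi).ne'
      have hxF : aeval x F = 0 := by
        rw [← aeval_map_algebraMap ℚ_[p]]
        exact aeval_eq_zero_of_dvd_aeval_eq_zero hqd hx
      refine ⟨⟨x, hintegral x ⟨F, hF, hxF⟩⟩, hxF, ?_⟩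
      exact (minpoly.eq_of_irreducible_of_monic hqi hx hq).symm
    · rintro ⟨x, hx, rfl⟩
      have hi : IsIntegral ℚ_[p] (x : PadicAlgCl p) := (hSint x hx).tower_top
      refine ⟨minpoly.monic hi, minpoly.irreducible hi, minpoly.dvd _ _ ?_⟩
      rw [aeval_map_algebraMap]
      exact hx
  have hBset : {q : Polynomial (ZMod p) | q.Monic ∧ Irreducible q ∧
        q ∣ F.map PadicInt.toZMod} = (fun x : V => minpoly (ZMod p) (r x)) '' S := by
    ext q
    constructor
    · rintro ⟨hq, hqi, hqd⟩
      have hs : (F.map (algebraMap ℤ_[p] (PadicAlgCl p))).Splits := IsAlgClosed.splits _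
      have hprod := hs.eq_prod_roots_of_monic (hF.map _)
      have hmem : ∀ x ∈ (F.map (algebraMap ℤ_[p] (PadicAlgCl p))).roots, aeval x F = 0 := by
        intro x hx
        rw [mem_roots ((hF.map _).ne_zero), IsRoot.def, eval_map_algebraMap] at hx
        exact hx
      have hmemV : ∀ x ∈ (F.map (algebraMap ℤ_[p] (PadicAlgCl p))).roots, x ∈ V :=
        fun x hx => hintegral x ⟨F, hF, hmem x hx⟩
      obtain ⟨s, hs'⟩ : ∃ s : Multiset V, s.map V.subtype =
          (F.map (algebraMap ℤ_[p] (PadicAlgCl p))).roots := by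
        refine ⟨(F.map (algebraMap ℤ_[p] (PadicAlgCl p))).roots.attach.map
          (fun x => ⟨x.1, hmemV x.1 x.2⟩), ?_⟩
        rw [Multiset.map_map]
        exact Multiset.attach_map_val _
      have hprodV : F.map φ = (s.map (fun x => X - C x)).prod := by
        apply map_injective V.subtype Subtype.val_injective
        rw [map_map, hφc, hprod, ← hs', Polynomial.map_multiset_prod, Multiset.map_map,
          Multiset.map_map]
        simp
      have hprodK : (F.map PadicInt.toZMod).map j = (s.map (fun x => X - C (r x))).prod := by
        rw [map_map, ← hrc, ← map_map, hprodV, Polynomial.map_multiset_prod, Multiset.map_map]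
        simp
      have hsplit : ((F.map PadicInt.toZMod).map j).Splits := by
        rw [hprodK]
        refine Splits.multisetProd ?_
        intro f hf
        obtain ⟨x, _, rfl⟩ := Multiset.mem_map.mp hf
        exact Splits.X_sub_C _
      have hqs : (q.map j).Splits := hsplit.of_dvd ((hF.map _).map _).ne_zero
        (map_dvd j hqd)
      obtain ⟨y, hy⟩ := hqs.exists_eval_eq_zero (by
        rw [degree_map]; exact (degree_pos_of_irreducible hqi).ne')
      have hyF : eval y ((F.map PadicInt.toZMod).map j) = 0 :=
        eval_eq_zero_of_dvd_of_eval_eq_zero (map_dvd j hqd) hy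
      rw [hprodK, eval_multiset_prod, Multiset.prod_eq_zero_iff, Multiset.map_map] at hyF
      obtain ⟨x, hxs, hx⟩ := Multiset.mem_map.mp hyF
      simp only [Function.comp_apply, eval_sub, eval_X, eval_C, sub_eq_zero] at hx
      refine ⟨x, hmem x ?_, ?_⟩
      · rw [← hs']
        exact Multiset.mem_map_of_mem V.subtype hxs
      · refine (minpoly.eq_of_irreducible_of_monic hqi ?_ hq).symm
        rw [← hx, aeval_def, ← eval_map, hjalg]
        exact hy
    · rintro ⟨x, hx, rfl⟩
      have hi := hSrint x hx
      exact ⟨minpoly.monic hi, minpoly.irreducible hi, minpoly.dvd _ _ (hSr x hx F hx)⟩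
  rw [hA, hBset]
  apply ncard_image_eq
  intro x hx y hy
  have hxi : IsIntegral ℚ_[p] (x : PadicAlgCl p) := (hSint x hx).tower_top
  have hyi : IsIntegral ℚ_[p] (y : PadicAlgCl p) := (hSint y hy).tower_top
  constructor
  · intro h
    obtain ⟨σ, hσxy⟩ := isConjRoot_iff_exists_algEquiv.mp (show IsConjRoot ℚ_[p] (y : PadicAlgCl p) x from h.symm)
    obtain ⟨G, hG⟩ := map_surjective (PadicInt.toZMod : ℤ_[p] →+* ZMod p)
      (ZMod.ringHom_surjective _) (minpoly (ZMod p) (r x))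
    have h1 : r (eval₂ φ x G) = 0 := by rw [ev2, hG, minpoly.aeval]
    have h2 : r (eval₂ φ y G) = 0 := by
      refine hσ σ (eval₂ φ x G) _ ?_ h1
      rw [ev1, ev1, ← hσxy, ← aeval_map_algebraMap ℚ_[p], ← aeval_map_algebraMap ℚ_[p] (x : PadicAlgCl p)]
      exact aeval_algHom_apply σ.toAlgHom _ _
    rw [ev2, hG] at h2
    exact minpoly.eq_of_irreducible_of_monic (minpoly.irreducible (hSrint x hx)) h2
      (minpoly.monic (hSrint x hx))
  · intro h
    by_contra hne
    have hfx := minpoly.isIntegrallyClosed_eq_field_fractions' ℚ_[p] (hSint x hx)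
    have hfy := minpoly.isIntegrallyClosed_eq_field_fractions' ℚ_[p] (hSint y hy)
    have hcop : IsCoprime (minpoly ℚ_[p] (x : PadicAlgCl p)) (minpoly ℚ_[p] (y : PadicAlgCl p)) := by
      refine ((minpoly.irreducible hxi).coprime_iff_not_dvd).mpr ?_
      intro hd
      apply hne
      exact eq_of_monic_of_associated (minpoly.monic hxi) (minpoly.monic hyi)
        ((minpoly.irreducible hxi).associated_of_dvd (minpoly.irreducible hyi) hd)
    have hmx := minpoly.monic (hSint x hx)
    have hmy := minpoly.monic (hSint y hy)
    have hdvd : minpoly ℤ_[p] (x : PadicAlgCl p) * minpoly ℤ_[p] (y : PadicAlgCl p) ∣ F := by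
      rw [← map_dvd_map (algebraMap ℤ_[p] ℚ_[p]) (IsFractionRing.injective _ _) (hmx.mul hmy),
        Polynomial.map_mul, ← hfx, ← hfy]
      refine hcop.mul_dvd (minpoly.dvd _ _ ?_) (minpoly.dvd _ _ ?_)
      · rw [aeval_map_algebraMap]; exact hx
      · rw [aeval_map_algebraMap]; exact hy
    have hc := hB _ _ hmx hmy hdvd
    have hd1 := minpoly.dvd (ZMod p) (r x) (hSr x hx _ (minpoly.aeval ℤ_[p] (x : PadicAlgCl p)))
    have hd2 := minpoly.dvd (ZMod p) (r y) (hSr y hy _ (minpoly.aeval ℤ_[p] (y : PadicAlgCl p)))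
    rw [← h] at hd2
    exact (minpoly.irreducible (hSrint x hx)).not_isUnit (hc.isUnit_of_dvd' hd1 hd2)

theorem padicInt_hom_zmod_unique (p : ℕ) [Fact p.Prime] (h : ℤ_[p] →+* ZMod p) :
    h = PadicInt.toZMod := by
  have hk : ∀ g : ℤ_[p] →+* ZMod p, RingHom.ker g = IsLocalRing.maximalIdeal ℤ_[p] := fun g =>
    IsLocalRing.eq_maximalIdeal (RingHom.ker_isMaximal_of_surjective g (ZMod.ringHom_surjective g))
  have key : ∀ (g : ℤ_[p] →+* ZMod p) (x : ℤ_[p]), g x = (x.zmodRepr : ZMod p) := by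
    intro g x
    have hx := PadicInt.sub_zmodRepr_mem (p := p) x
    rw [← hk g, RingHom.mem_ker, map_sub, map_natCast, sub_eq_zero] at hx
    exact hx
  ext x
  rw [key h, key]

section Witt

open WittVector

variable {p : ℕ} [Fact p.Prime] {k : Type} [Field k] [CharP k p] [PerfectRing k p]

theorem witt_p_dvd (x : WittVector p k) (hx : constantCoeff x = 0) : (p : WittVector p k) ∣ x := by
  by_cases h0 : x = 0
  · rw [h0]; exact dvd_zero _
  obtain ⟨m, b, hb, rfl⟩ := exists_eq_pow_p_mul x h0
  rcases m with _ | m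
  · rw [pow_zero, one_mul] at hx
    exact absurd hx hb
  · exact Dvd.dvd.mul_right (dvd_pow_self _ (Nat.succ_ne_zero m)) _

theorem witt_not_p_sq_dvd (u : WittVector p k) (hu : constantCoeff u ≠ 0) :
    ¬ (p : WittVector p k) ^ 2 ∣ p * u := by
  rintro ⟨w, hw⟩
  have : u = p * w := mul_left_cancel₀ (p_nonzero p k) (by rw [hw]; ring)
  apply hu
  rw [this, map_mul, map_natCast, CharP.cast_eq_zero, zero_mul]

theorem constantCoeff_eval_cyc (n : ℕ) (x : WittVector p k) :
    constantCoeff (eval x (cyclotomic n (WittVector p k))) =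
      eval (constantCoeff x) (cyclotomic n k) := by
  rw [← map_cyclotomic n (constantCoeff : WittVector p k →+* k), eval_map, ← eval₂_hom]

theorem constantCoeff_eval_deriv_cyc (m : ℕ) (hm : ¬ p ∣ m) (x : WittVector p k)
    (hx : eval x (cyclotomic m (WittVector p k)) = 0) :
    constantCoeff (eval x (derivative (cyclotomic m (WittVector p k)))) ≠ 0 := by
  have hmk : NeZero (m : k) := ⟨by rwa [Ne, CharP.cast_eq_zero_iff k p]⟩
  have h1 : eval (constantCoeff x) (cyclotomic m k) = 0 := by
    rw [← constantCoeff_eval_cyc, hx, map_zero]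
  have h2 := (separable_cyclotomic m k).eval₂_derivative_ne_zero (RingHom.id k)
    (x := constantCoeff x) (by rw [eval₂_id]; exact h1)
  rw [← eval₂_hom, ← eval_map, ← derivative_map, map_cyclotomic]
  rwa [eval₂_id] at h2

theorem witt_ramified (m : ℕ) (hm : ¬ p ∣ m) (a : ℕ) :
    ∀ θ : WittVector p k, IsPrimitiveRoot θ m →
      ¬ (p : WittVector p k) ^ 2 ∣ eval θ (cyclotomic (m * p ^ (a + 1)) (WittVector p k)) := by
  have hp : p.Prime := Fact.out
  have hmpos : 0 < m := Nat.pos_of_ne_zero (by rintro rfl; exact hm (dvd_zero _))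
  have hcop : p.Coprime m := (Nat.Prime.coprime_iff_not_dvd hp).mpr hm
  induction a with
  | zero =>
    intro θ hθ hd
    have h1 := congrArg derivative (cyclotomic_expand_eq_cyclotomic_mul hp hm (WittVector p k))
    rw [derivative_expand, derivative_mul] at h1
    have h2 := congrArg (eval θ) h1
    have hroot : eval θ (cyclotomic m (WittVector p k)) = 0 := hθ.isRoot_cyclotomic hmpos
    have hroot2 : eval (θ ^ p) (cyclotomic m (WittVector p k)) = 0 :=
      (hθ.pow_of_coprime p hcop).isRoot_cyclotomic hmpos
    simp only [eval_mul, eval_add, expand_eval, eval_pow, eval_X, eval_natCast, hroot, mul_zero,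
      zero_add] at h2
    have hu := constantCoeff_eval_deriv_cyc m hm _ hroot2
    have hθ0 : constantCoeff θ ≠ 0 := by
      intro h0
      have := congrArg (constantCoeff : WittVector p k →+* k) hθ.pow_eq_one
      rw [map_pow, h0, map_one, zero_pow hmpos.ne'] at this
      exact zero_ne_one this
    refine witt_not_p_sq_dvd (eval (θ ^ p) (derivative (cyclotomic m (WittVector p k))) * θ ^ (p - 1))
      ?_ ?_
    · rw [map_mul, map_pow]
      exact mul_ne_zero hu (pow_ne_zero _ hθ0)
    · rw [zero_add, pow_one] at hd
      have h3 := hd.mul_right (eval θ (derivative (cyclotomic m (WittVector p k))))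
      convert h3 using 1
      linear_combination h2
  | succ a ih =>
    intro θ hθ
    have h1 := cyclotomic_expand_eq_cyclotomic (n := m * p ^ (a + 1)) hp
      (Dvd.dvd.mul_left (dvd_pow_self p (Nat.succ_ne_zero a)) m) (WittVector p k)
    rw [pow_succ p (a + 1), ← mul_assoc, ← h1, expand_eval]
    exact ih _ (hθ.pow_of_coprime p hcop)

theorem witt_exists_lift (n : ℕ) (hn : 0 < n) (ζ : k) (hζ : eval ζ (cyclotomic n k) = 0) :
    ∃ θ : WittVector p k, constantCoeff θ = ζ ∧
      ¬ (p : WittVector p k) ^ 2 ∣ eval θ (cyclotomic n (WittVector p k)) := by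
  have hp : p.Prime := Fact.out
  obtain ⟨a, m, hm, rfl⟩ := Nat.exists_eq_pow_mul_and_not_dvd hn.ne' p hp.ne_one
  have hmpos : 0 < m := Nat.pos_of_ne_zero (by rintro rfl; exact hm (dvd_zero _))
  have hmk : NeZero (m : k) := ⟨by rwa [Ne, CharP.cast_eq_zero_iff k p]⟩
  have hprim : IsPrimitiveRoot ζ m := isRoot_cyclotomic_prime_pow_mul_iff_of_charP.mp hζ
  have hinj : Function.Injective (teichmuller p : k →* WittVector p k) := by
    intro x y hxy
    have := congrArg (fun w : WittVector p k => w.coeff 0) hxy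
    simpa using this
  have hθ : IsPrimitiveRoot (teichmuller p ζ) m := hprim.map_of_injective hinj
  have hc : constantCoeff (teichmuller p ζ) = ζ := rfl
  rcases a with _ | a
  · refine ⟨teichmuller p ζ + p, by rw [map_add, hc, map_natCast, CharP.cast_eq_zero, add_zero], ?_⟩
    rw [pow_zero, one_mul]
    obtain ⟨w, hw⟩ := binomExpansion (cyclotomic m (WittVector p k)) (teichmuller p ζ) p
    have hroot : eval (teichmuller p ζ) (cyclotomic m (WittVector p k)) = 0 :=
      hθ.isRoot_cyclotomic hmpos
    rw [hw, hroot, zero_add]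
    intro hd
    rw [dvd_add_left (Dvd.intro_left w rfl), mul_comm] at hd
    exact witt_not_p_sq_dvd _ (constantCoeff_eval_deriv_cyc m hm _ hroot) hd
  · refine ⟨teichmuller p ζ, hc, ?_⟩
    rw [mul_comm]
    exact witt_ramified m hm a _ hθ

end Witt

theorem exists_root_not_coprime (p : ℕ) [Fact p.Prime] (A B : (ZMod p)[X])
    (hA : A ≠ 0) (h : ¬ IsCoprime A B) : ∃ x : AlgebraicClosure (ZMod p), aeval x A = 0 ∧ aeval x B = 0 := by
  obtain ⟨q, hq, hqA, hqB⟩ : ∃ q, Irreducible q ∧ q ∣ A ∧ q ∣ B := by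
    by_contra! hcon
    apply h
    refine isCoprime_of_irreducible_dvd (fun h => hA h.1) ?_
    intro q hq h1
    exact hcon q hq h1
  obtain ⟨x, hx⟩ := IsAlgClosed.exists_aeval_eq_zero (AlgebraicClosure (ZMod p)) q
    (degree_pos_of_irreducible hq).ne'
  exact ⟨x, aeval_eq_zero_of_dvd_aeval_eq_zero hqA hx, aeval_eq_zero_of_dvd_aeval_eq_zero hqB hx⟩

noncomputable def padicToWitt (p : ℕ) [Fact p.Prime] :
    ℤ_[p] →+* WittVector p (AlgebraicClosure (ZMod p)) :=
  (WittVector.map (algebraMap (ZMod p) (AlgebraicClosure (ZMod p)))).comp (WittVector.fromPadicInt p)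

theorem constantCoeff_padicToWitt (p : ℕ) [Fact p.Prime] :
    (WittVector.constantCoeff).comp (padicToWitt p) =
      (algebraMap (ZMod p) (AlgebraicClosure (ZMod p))).comp PadicInt.toZMod := by
  rw [← padicInt_hom_zmod_unique p (WittVector.constantCoeff.comp (WittVector.fromPadicInt p))]
  rfl

/-- If the reductions of `A` and `B` vanish at the residue of `y`, then `p²` divides `A(y)B(y)`. -/
theorem p_sq_dvd_eval (p : ℕ) [Fact p.Prime] (A B : ℤ_[p][X])
    (y : WittVector p (AlgebraicClosure (ZMod p)))
    (hA : aeval (WittVector.constantCoeff y) (A.map PadicInt.toZMod) = 0)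
    (hB : aeval (WittVector.constantCoeff y) (B.map PadicInt.toZMod) = 0) :
    (p : WittVector p (AlgebraicClosure (ZMod p))) ^ 2 ∣
      eval₂ (padicToWitt p) y (A * B) := by
  have key : ∀ A : ℤ_[p][X], aeval (WittVector.constantCoeff y) (A.map PadicInt.toZMod) = 0 →
      (p : WittVector p (AlgebraicClosure (ZMod p))) ∣ eval₂ (padicToWitt p) y A := by
    intro A hA
    apply witt_p_dvd
    rw [hom_eval₂, constantCoeff_padicToWitt, ← eval₂_map]
    exact hA
  rw [eval₂_mul, pow_two]
  exact mul_dvd_mul (key A hA) (key B hB)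

theorem ncard_factors_of_lift (p : ℕ) [Fact p.Prime] (F : ℤ[X]) (hF : F.Monic)
    (h : ∀ x : AlgebraicClosure (ZMod p), eval₂ (Int.castRingHom _) x F = 0 →
      ∃ y : WittVector p (AlgebraicClosure (ZMod p)), WittVector.constantCoeff y = x ∧
        ¬ (p : WittVector p (AlgebraicClosure (ZMod p))) ^ 2 ∣ eval₂ (Int.castRingHom _) y F) :
    {q : Polynomial ℚ_[p] | q.Monic ∧ Irreducible q ∧
        q ∣ F.map (Int.castRingHom ℚ_[p])}.ncard =
      {q : Polynomial (ZMod p) | q.Monic ∧ Irreducible q ∧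
        q ∣ F.map (Int.castRingHom (ZMod p))}.ncard := by
  have key := ncard_factors_padic_eq p (F.map (Int.castRingHom ℤ_[p])) (hF.map _) ?_
  · rw [map_map, map_map] at key
    rw [RingHom.ext_int (Int.castRingHom ℚ_[p])
      ((algebraMap ℤ_[p] ℚ_[p]).comp (Int.castRingHom ℤ_[p])),
      RingHom.ext_int (Int.castRingHom (ZMod p))
      ((PadicInt.toZMod).comp (Int.castRingHom ℤ_[p]))]
    exact key
  · rintro A B hA hB ⟨D, hD⟩
    by_contra hcop
    obtain ⟨x, hxA, hxB⟩ := exists_root_not_coprime p _ _ (hA.map PadicInt.toZMod).ne_zero hcop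
    obtain ⟨y, hy, hnd⟩ := h x (by
      have h1 : aeval x ((F.map (Int.castRingHom ℤ_[p])).map PadicInt.toZMod) = 0 := by
        rw [hD, Polynomial.map_mul, Polynomial.map_mul, map_mul, map_mul, hxA, zero_mul, zero_mul]
      rw [map_map, aeval_def, eval₂_map] at h1
      rw [← h1]
      congr 1
      exact RingHom.ext_int _ _)
    apply hnd
    have h2 : eval₂ (Int.castRingHom _) y F =
        eval₂ (padicToWitt p) y (F.map (Int.castRingHom ℤ_[p])) := by
      rw [eval₂_map]
      congr 1
      exact RingHom.ext_int _ _
    rw [h2, hD, eval₂_mul]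
    exact (p_sq_dvd_eval p A B y (by rw [hy]; exact hxA) (by rw [hy]; exact hxB)).mul_right _

/-- The polynomial identity behind the trace polynomial. -/
theorem trace_identity (n : ℕ) (h : ℕ) (Ψ : ℤ[X]) (hdeg : Ψ.natDegree = h)
    (hΨ : ∀ z : ℂ, z ≠ 0 →
      (cyclotomic n ℤ).eval₂ (Int.castRingHom ℂ) z =
        z ^ h * Ψ.eval₂ (Int.castRingHom ℂ) (z + z⁻¹)) :
    cyclotomic n ℤ = ∑ i ∈ Finset.range (h + 1), C (Ψ.coeff i) * ((X ^ 2 + 1) ^ i * X ^ (h - i)) := by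
  apply map_injective (Int.castRingHom ℂ) Int.cast_injective
  apply eq_of_infinite_eval_eq
  refine Set.Infinite.mono (s := {z : ℂ | z ≠ 0}) ?_ ?_
  · intro z hz
    have hz : z ≠ 0 := hz
    change _ = _
    rw [eval_map, hΨ z hz, eval_map, eval₂_finsetSum, eval₂_eq_sum_range, hdeg, Finset.mul_sum]
    apply Finset.sum_congr rfl
    intro i hi
    have hi' : i ≤ h := Nat.lt_succ_iff.mp (Finset.mem_range.mp hi)
    simp only [eval₂_mul, eval₂_C, eval₂_pow, eval₂_add, eval₂_X, eval₂_one]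
    have h1 : z ^ 2 + 1 = z * (z + z⁻¹) := by field_simp
    have h2 : z ^ h = z ^ i * z ^ (h - i) := by rw [← pow_add, Nat.add_sub_cancel' hi']
    rw [h1, h2, mul_pow]
    ring
  · exact (Set.finite_singleton (0 : ℂ)).infinite_compl

theorem trace_eval {R : Type*} [CommRing R] (n : ℕ) (h : ℕ) (Ψ : ℤ[X]) (hdeg : Ψ.natDegree = h)
    (hid : cyclotomic n ℤ =
      ∑ i ∈ Finset.range (h + 1), C (Ψ.coeff i) * ((X ^ 2 + 1) ^ i * X ^ (h - i)))
    (u v : R) (huv : u * v = 1) :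
    eval₂ (Int.castRingHom R) u (cyclotomic n ℤ) =
      u ^ h * eval₂ (Int.castRingHom R) (u + v) Ψ := by
  rw [hid, eval₂_finsetSum, eval₂_eq_sum_range, hdeg, Finset.mul_sum]
  apply Finset.sum_congr rfl
  intro i hi
  have hi' : i ≤ h := Nat.lt_succ_iff.mp (Finset.mem_range.mp hi)
  simp only [eval₂_mul, eval₂_C, eval₂_pow, eval₂_add, eval₂_X, eval₂_one]
  have h1 : u ^ 2 + 1 = u * (u + v) := by rw [mul_add, huv]; ring
  have h2 : u ^ h = u ^ i * u ^ (h - i) := by rw [← pow_add, Nat.add_sub_cancel' hi']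
  rw [h1, h2, mul_pow]
  ring

theorem trace_monic (n : ℕ) (h : ℕ) (hn : n.totient = 2 * h) (Ψ : ℤ[X]) (hdeg : Ψ.natDegree = h)
    (hid : cyclotomic n ℤ =
      ∑ i ∈ Finset.range (h + 1), C (Ψ.coeff i) * ((X ^ 2 + 1) ^ i * X ^ (h - i))) :
    Ψ.Monic := by
  have h1 : (cyclotomic n ℤ).coeff (2 * h) = 1 := by
    rw [← hn, ← natDegree_cyclotomic n ℤ]
    exact cyclotomic.monic n ℤ
  have hm2 : (X ^ 2 + 1 : ℤ[X]).Monic := monic_X_pow_add_C 1 two_ne_zero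
  have hd2 : (X ^ 2 + 1 : ℤ[X]).natDegree = 2 := natDegree_X_pow_add_C (r := (1 : ℤ))
  rw [hid, finsetSum_coeff, Finset.sum_range_succ, Finset.sum_eq_zero, zero_add, Nat.sub_self,
    pow_zero, mul_one, coeff_C_mul] at h1
  · have h3 : ((X ^ 2 + 1 : ℤ[X]) ^ h).coeff (2 * h) = 1 := by
      have := (hm2.pow h).coeff_natDegree
      rwa [hm2.natDegree_pow, hd2, mul_comm] at this
    rw [h3, mul_one, ← hdeg] at h1
    exact h1
  · intro i hi
    have hi' := Finset.mem_range.mp hi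
    rw [coeff_C_mul]
    refine mul_eq_zero_of_right _ (coeff_eq_zero_of_natDegree_lt ?_)
    rw [(hm2.pow i).natDegree_mul (monic_X_pow _), hm2.natDegree_pow, hd2, natDegree_X_pow]
    omega

theorem eval2_cyc {R : Type*} [CommRing R] (n : ℕ) (x : R) :
    eval₂ (Int.castRingHom R) x (cyclotomic n ℤ) = eval x (cyclotomic n R) := by
  rw [← eval_map, map_cyclotomic]


/-- Let `n ≥ 3`, `p` prime, and let `Ψ_n` be the trace polynomial of `Φ_n`, i.e. the
unique polynomial of degree `φ(n)/2` with `Φ_n(z) = z^(φ(n)/2)·Ψ_n(z + z⁻¹)` for all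
`z ≠ 0`.  Then the number of distinct monic irreducible factors of `Φ_n` over `ℚ_p`
equals the number of distinct monic irreducible factors of `Φ_n mod p` over `𝔽_p`, and
likewise for `Ψ_n`. -/
theorem ncard_factors_cyclotomic_padic_eq_mod (n p : ℕ) [Fact p.Prime] (hn : 3 ≤ n)
    (Ψ : ℤ[X]) (hΨdeg : Ψ.natDegree = n.totient / 2)
    (hΨ : ∀ z : ℂ, z ≠ 0 →
      (Polynomial.cyclotomic n ℤ).eval₂ (Int.castRingHom ℂ) z =
        z ^ (n.totient / 2) * Ψ.eval₂ (Int.castRingHom ℂ) (z + z⁻¹)) :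
    {q : Polynomial ℚ_[p] | q.Monic ∧ Irreducible q ∧
        q ∣ (Polynomial.cyclotomic n ℤ).map (Int.castRingHom ℚ_[p])}.ncard =
      {q : Polynomial (ZMod p) | q.Monic ∧ Irreducible q ∧
        q ∣ (Polynomial.cyclotomic n ℤ).map (Int.castRingHom (ZMod p))}.ncard ∧
    {q : Polynomial ℚ_[p] | q.Monic ∧ Irreducible q ∧
        q ∣ Ψ.map (Int.castRingHom ℚ_[p])}.ncard =
      {q : Polynomial (ZMod p) | q.Monic ∧ Irreducible q ∧
        q ∣ Ψ.map (Int.castRingHom (ZMod p))}.ncard := by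
  have hn0 : 0 < n := by omega
  refine ⟨ncard_factors_of_lift p _ (cyclotomic.monic n ℤ) ?_, ?_⟩
  · intro x hx
    rw [eval2_cyc] at hx
    obtain ⟨θ, hθ, hnd⟩ := witt_exists_lift (p := p) n hn0 x hx
    exact ⟨θ, hθ, by rwa [eval2_cyc]⟩
  · have hid := trace_identity n _ Ψ hΨdeg hΨ
    have heven : n.totient = 2 * (n.totient / 2) :=
      (Nat.two_mul_div_two_of_even (Nat.totient_even (by omega))).symm
    refine ncard_factors_of_lift p _ (trace_monic n _ heven Ψ hΨdeg hid) ?_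
    intro y hy
    obtain ⟨x, hx⟩ := IsAlgClosed.exists_root (X ^ 2 - C y * X + 1 : (AlgebraicClosure (ZMod p))[X])
      (by
        have : (X ^ 2 - C y * X + 1 : (AlgebraicClosure (ZMod p))[X]).degree = 2 := by
          compute_degree!
        rw [this]; exact two_ne_zero)
    simp only [IsRoot.def, eval_add, eval_sub, eval_pow, eval_X, eval_mul, eval_C, eval_one] at hx
    have huv : x * (y - x) = 1 := by linear_combination -hx
    have hcyc : eval x (cyclotomic n (AlgebraicClosure (ZMod p))) = 0 := by
      rw [← eval2_cyc, trace_eval n _ Ψ hΨdeg hid x (y - x) huv, add_sub_cancel, hy, mul_zero]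
    obtain ⟨θ, hθ, hnd⟩ := witt_exists_lift (p := p) n hn0 x hcyc
    have hx0 : x ≠ 0 := left_ne_zero_of_mul_eq_one huv
    have hunit : IsUnit θ := WittVector.isUnit_of_coeff_zero_ne_zero θ (by
      rw [← WittVector.constantCoeff_apply, hθ]; exact hx0)
    obtain ⟨v, hv⟩ := hunit.exists_right_inv
    refine ⟨θ + v, ?_, ?_⟩
    · have h1 := congrArg (WittVector.constantCoeff) hv
      rw [map_mul, map_one, hθ, ← huv] at h1
      rw [map_add, hθ, mul_left_cancel₀ hx0 h1, add_sub_cancel]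
    · intro hd
      apply hnd
      rw [← eval2_cyc, trace_eval n _ Ψ hΨdeg hid θ v hv]
      exact hd.mul_left _
end

section
/- Let p be a prime and n a positive integer. (i) If n = p^e for some e ≥ 0, then Ī(Φ_n;ℚ_p) = {X−1}. (ii) If n = 2·p^e for some e ≥ 0, then Ī(Φ_n;ℚ_p) = {X+1}. (iii) If n = p^e·m for some e ≥ 0 and some m ≥ 3 with p ∤ m, then: if there exists r ≥ 0 with p^r ≡ −1 (mod m), Ī(Φ_n;ℚ_p) equals the set of monic irreducible factors of the image of Φ_m in 𝔽_p[X]; otherwise Ī(Φ_n;ℚ_p) = ∅. -/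
open Polynomial

/-- `Ī(f;ℚ_p)`: the set of monic irreducible polynomials `h̄ ∈ 𝔽_p[X]` such that some
monic irreducible `*`-symmetric factor `k` of `f` in `ℤ_p[X]` has reduction modulo `p`
divisible by `h̄`.  (A monic `k` with invertible constant term is `*`-symmetric iff
`reverse k = k(0)·k`.) -/
def IbarSet (p : ℕ) [Fact p.Prime] (f : Polynomial ℤ) : Set (Polynomial (ZMod p)) :=
  {h | h.Monic ∧ Irreducible h ∧
    ∃ k : Polynomial ℤ_[p], k.Monic ∧ Irreducible k ∧
      k.reverse = Polynomial.C (k.eval 0) * k ∧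
      k ∣ f.map (Int.castRingHom ℤ_[p]) ∧
      h ∣ k.map (PadicInt.toZMod : ℤ_[p] →+* ZMod p)}

namespace IbarAux

variable (p : ℕ) [hp : Fact p.Prime]

abbrev F := AlgebraicClosure (ZMod p)
abbrev W := WittVector p (F p)

instance : CharP (F p) p := charP_of_injective_algebraMap (algebraMap (ZMod p) (F p)).injective p

noncomputable def iota : ℤ_[p] →+* W p :=
  (WittVector.map (algebraMap (ZMod p) (F p))).comp (WittVector.equiv p).symm.toRingHom

noncomputable def red : W p →+* F p := WittVector.constantCoeff

lemma iota_injective : Function.Injective (iota p) := by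
  refine Function.Injective.comp (g := WittVector.map (algebraMap (ZMod p) (F p)))
    (WittVector.map_injective _ (algebraMap (ZMod p) (F p)).injective)
    (WittVector.equiv p).symm.injective

lemma hom_eq (f : ℤ_[p] →+* F p) : f = (algebraMap (ZMod p) (F p)).comp PadicInt.toZMod := by
  ext x
  have h := PadicInt.toZMod_spec (p := p) x
  rw [PadicInt.maximalIdeal_eq_span_p, Ideal.mem_span_singleton] at h
  obtain ⟨y, hy⟩ := h
  have h2 : x = ((PadicInt.toZMod x).val : ℤ_[p]) + p * y := by
    rw [← hy, ZMod.natCast_val]; ring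
  have h3 : f x = ((PadicInt.toZMod x).val : F p) := by
    conv_lhs => rw [h2]
    simp
  rw [h3]
  simp only [RingHom.comp_apply]
  conv_rhs => rw [← ZMod.natCast_zmod_val (PadicInt.toZMod x)]
  simp

lemma red_iota : (red p).comp (iota p) = (algebraMap (ZMod p) (F p)).comp PadicInt.toZMod :=
  hom_eq p _

lemma dvd_of_red {x : W p} (h : red p x = 0) : (p : W p) ∣ x := by
  rw [← Ideal.mem_span_singleton, WittVector.mem_span_p_iff_coeff_zero_eq_zero]
  exact h

lemma red_p : red p (p : W p) = 0 := by simp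

lemma red_teich (a : F p) : red p (WittVector.teichmuller p a) = a :=
  WittVector.teichmuller_coeff_zero p a

lemma p_ne : (p : W p) ≠ 0 := by
  exact WittVector.p_nonzero p (F p)

lemma frob_teich (a : F p) : WittVector.frobenius (WittVector.teichmuller p a) =
    (WittVector.teichmuller p a) ^ p := by
  rw [WittVector.frobenius_eq_map_frobenius, WittVector.map_teichmuller, frobenius_def, map_pow]

lemma mem_range_of_frob {x : W p} (h : WittVector.frobenius x = x) : x ∈ (iota p).range := by
  have hc : ∀ n, ∃ c : ZMod p, algebraMap (ZMod p) (F p) c = x.coeff n := by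
    intro n
    have h1 : x.coeff n ^ p = x.coeff n := by
      rw [← WittVector.coeff_frobenius_charP, h]
    rw [← Subfield.mem_bot_iff_pow_eq_self, ← ZMod.fieldRange_castHom_eq_bot p] at h1
    obtain ⟨c, hc⟩ := h1
    exact ⟨c, by rw [← hc]; congr 1; exact Subsingleton.elim _ _⟩
  choose c hc using hc
  refine ⟨WittVector.equiv p (WittVector.mk p c), ?_⟩
  simp only [iota, RingHom.comp_apply]
  ext n
  simp [WittVector.map_coeff, hc]

/-- a monic polynomial dividing its reverse -/
lemma dvd_reverse {R : Type*} [CommRing R] [IsDomain R] {f : R[X]} (hf : f.Monic)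
    (h : f ∣ f.reverse) : f.reverse = C (f.eval 0) * f ∧ IsUnit (f.eval 0) := by
  obtain ⟨c, hc⟩ := h
  have hr0 : f.reverse ≠ 0 := by
    rw [Ne, reverse_eq_zero]; exact hf.ne_zero
  have hc0 : c ≠ 0 := by rintro rfl; simp [hc] at hr0
  have hd : c.natDegree = 0 := by
    have := reverse_natDegree_le f
    rw [hc, natDegree_mul hf.ne_zero hc0] at this
    omega
  obtain ⟨a, rfl⟩ := natDegree_eq_zero.1 hd
  have h1 : f.reverse.coeff f.natDegree = f.coeff 0 := by
    rw [coeff_reverse, revAt_le le_rfl, Nat.sub_self]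
  have h2 : f.reverse.coeff 0 = 1 := by rw [coeff_zero_reverse, hf.leadingCoeff]
  rw [hc, coeff_mul_C, hf.coeff_natDegree, one_mul] at h1
  rw [hc, coeff_mul_C] at h2
  rw [← coeff_zero_eq_eval_zero, hc, h1]
  refine ⟨mul_comm _ _, ?_⟩
  rw [h1] at h2
  exact IsUnit.of_mul_eq_one _ h2

lemma cyclo_reverse {n : ℕ} (hn : 0 < n) : (cyclotomic n ℤ).reverse ∣ cyclotomic n ℤ := by
  have hz := Complex.isPrimitiveRoot_exp n hn.ne'
  set z := Complex.exp (2 * Real.pi * Complex.I / n)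
  have hz0 : z ≠ 0 := hz.ne_zero hn.ne'
  have h1 : cyclotomic n ℤ ∣ (cyclotomic n ℤ).reverse := by
    conv_lhs => rw [cyclotomic_eq_minpoly hz.inv hn]
    apply minpoly.isIntegrallyClosed_dvd (hz.inv.isIntegral hn)
    let _ := invertibleOfNonzero hz0
    rw [aeval_def, ← invOf_eq_inv, eval₂_reverse_eq_zero_iff, cyclotomic_eq_minpoly hz hn,
      ← aeval_def, minpoly.aeval]
  obtain ⟨h2, h3⟩ := dvd_reverse (cyclotomic.monic n ℤ) h1
  rw [h2]
  exact (h3.map C).mul_left_dvd.2 dvd_rfl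

lemma map_reverse_inj {R S : Type*} [CommRing R] [CommRing S] (f : R →+* S)
    (hf : Function.Injective f) (q : R[X]) : (q.map f).reverse = q.reverse.map f := by
  rw [reverse, reverse, reflect_map, natDegree_map_eq_of_injective hf]

lemma cyclo_reverse_padic {n : ℕ} (hn : 0 < n) :
    (cyclotomic n ℤ_[p]).reverse ∣ cyclotomic n ℤ_[p] := by
  rw [← map_cyclotomic_int, map_reverse_inj _ (RingHom.injective_int _)]
  exact Polynomial.map_dvd _ (cyclo_reverse hn)

/-- valuation of the cyclotomic polynomial at a primitive root of order prime to p -/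
lemma not_sq_dvd {m : ℕ} (hm : ¬ p ∣ m) (w : F p) (hw : IsPrimitiveRoot w m) (e : ℕ) :
    ¬ (p : W p) ^ 2 ∣ (cyclotomic (p ^ (e + 1) * m) (W p)).eval (WittVector.teichmuller p w) := by
  have hpp := hp.out
  induction e generalizing w with
  | zero =>
    have hm0 : 0 < m := Nat.pos_of_ne_zero (by rintro rfl; simp at hm)
    have : NeZero (m : F p) := ⟨by rwa [Ne, CharP.cast_eq_zero_iff (F p) p]⟩
    set t := WittVector.teichmuller p w with ht
    have htm : IsPrimitiveRoot t m := hw.map_of_injective (f := WittVector.teichmuller p)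
      (fun a b hab => by rw [← red_teich p a, hab, red_teich])
    have hroot : (cyclotomic m (W p)).eval t = 0 := htm.isRoot_cyclotomic hm0
    have key := congrArg (fun q => (derivative q).eval t)
      (cyclotomic_expand_eq_cyclotomic_mul hpp hm (W p))
    simp only [derivative_expand, derivative_mul, eval_mul, eval_add, hroot, mul_zero, zero_add,
      expand_eval] at key
    intro ⟨y, hy⟩
    rw [zero_add, pow_one, mul_comm] at hy
    rw [hy] at key
    have key2 : (derivative (cyclotomic m (W p))).eval (t ^ p) * t ^ (p - 1) =
        p * (y * (derivative (cyclotomic m (W p))).eval t) := by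
      apply mul_left_cancel₀ (p_ne p)
      simp at key
      linear_combination key
    have key3 := congrArg (red p) key2
    rw [map_mul, map_mul, red_p, zero_mul, mul_eq_zero, map_pow, red_teich] at key3
    rcases key3 with h | h
    · rw [← eval_map_apply, map_pow, red_teich, ← derivative_map, map_cyclotomic] at h
      have hs := separable_cyclotomic m (F p)
      have hr : (cyclotomic m (F p)).eval (w ^ p) = 0 :=
        (hw.pow_of_coprime p ((Nat.Prime.coprime_iff_not_dvd hpp).2 hm)).isRoot_cyclotomic hm0
      obtain ⟨a, b, hab⟩ := hs
      have := congrArg (eval (w ^ p)) hab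
      simp [hr, h] at this
    · exact hw.ne_zero hm0.ne' (eq_zero_of_pow_eq_zero h)
  | succ e ih =>
    have hd : p ∣ p ^ (e + 1) * m := Dvd.dvd.mul_right (dvd_pow_self p (by omega)) m
    have h1 := cyclotomic_expand_eq_cyclotomic hpp hd (W p)
    have h2 : p ^ (e + 1) * m * p = p ^ (e + 1 + 1) * m := by ring
    rw [h2] at h1
    rw [← h1, expand_eval, ← map_pow]
    exact ih _ (hw.pow_of_coprime p ((Nat.Prime.coprime_iff_not_dvd hpp).2 hm))

noncomputable abbrev phi : ℤ_[p] →+* F p := (algebraMap (ZMod p) (F p)).comp PadicInt.toZMod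

lemma eval_frob (k : ℤ_[p][X]) (w : F p) (h : eval₂ (phi p) w k = 0) (r : ℕ) :
    eval₂ (phi p) (w ^ p ^ r) k = 0 := by
  have h0 : ∀ x, eval₂ (phi p) x k = aeval x (k.map PadicInt.toZMod) := by
    intro x; rw [aeval_def, eval₂_map]
  induction r with
  | zero => simpa using h
  | succ r ih =>
    rw [h0] at ih ⊢
    rw [pow_succ, pow_mul, ← expand_aeval, ZMod.expand_card, map_pow, ih, zero_pow hp.out.ne_zero]

lemma inv_eq {M : Type*} [Field M] {m : ℕ} {r : ℕ} (hr : (p : ZMod m) ^ r = -1)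
    {w : M} (hw : IsPrimitiveRoot w m) : w ^ p ^ r = w⁻¹ := by
  have h1 : m ∣ p ^ r + 1 := by
    rw [← ZMod.natCast_eq_zero_iff]; push_cast; rw [hr]; ring
  apply eq_inv_of_mul_eq_one_left
  rw [← pow_succ, hw.pow_eq_one_iff_dvd]
  exact h1

lemma exists_root_red {k : ℤ_[p][X]} (hk : k.Monic) (hirr : Irreducible k) :
    ∃ w, eval₂ (phi p) w k = 0 := by
  have : (k.map (phi p)).degree ≠ 0 := by
    rw [hk.degree_map]
    intro h
    exact hirr.not_isUnit
      (by rw [hk.natDegree_eq_zero.1 (natDegree_eq_of_degree_eq_some h)]; exact isUnit_one)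
  obtain ⟨w, hw⟩ := IsAlgClosed.exists_root _ this
  exact ⟨w, by rwa [IsRoot, eval_map] at hw⟩

lemma prim_of_root {e m : ℕ} (hm : ¬ p ∣ m) {k : ℤ_[p][X]}
    (hdvd : k ∣ cyclotomic (p ^ e * m) ℤ_[p]) {w : F p} (hw : eval₂ (phi p) w k = 0) :
    IsPrimitiveRoot w m := by
  have : NeZero (m : F p) := ⟨by rwa [Ne, CharP.cast_eq_zero_iff (F p) p]⟩
  rw [← isRoot_cyclotomic_prime_pow_mul_iff_of_charP (p := p) (k := e), IsRoot,
    ← map_cyclotomic _ (phi p), eval_map]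
  exact eval₂_eq_zero_of_dvd_of_eval₂_eq_zero _ _ hdvd hw

lemma symm_of_neg_one {e m r : ℕ} (hm : ¬ p ∣ m) (hr : (p : ZMod m) ^ r = -1)
    {k : ℤ_[p][X]} (hk : k.Monic) (hirr : Irreducible k)
    (hdvd : k ∣ cyclotomic (p ^ e * m) ℤ_[p]) : k.reverse = C (k.eval 0) * k := by
  by_contra hne
  have hm0 : 0 < m := Nat.pos_of_ne_zero (by rintro rfl; simp at hm)
  have hnd : ¬ k ∣ k.reverse := fun h => hne (dvd_reverse hk h).1
  have hn : 0 < p ^ e * m := Nat.mul_pos (pow_pos hp.out.pos e) hm0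
  have hrev : k.reverse ∣ cyclotomic (p ^ e * m) ℤ_[p] := by
    refine dvd_trans ?_ (cyclo_reverse_padic p hn)
    obtain ⟨a, ha⟩ := hdvd
    rw [ha, reverse_mul_of_domain]
    exact dvd_mul_right _ _
  have hprod : k.reverse * k ∣ cyclotomic (p ^ e * m) ℤ_[p] := by
    obtain ⟨b, hb⟩ := hrev
    rw [hb] at hdvd ⊢
    exact mul_dvd_mul_left _ ((hirr.prime.dvd_or_dvd hdvd).resolve_left hnd)
  obtain ⟨w, hw⟩ := exists_root_red p hk hirr
  have hprim := prim_of_root p hm hdvd hw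
  have hw0 : w ≠ 0 := hprim.ne_zero hm0.ne'
  have hw' : eval₂ (phi p) w k.reverse = 0 := by
    have h1 := eval_frob p k w hw r
    rw [inv_eq p hr hprim] at h1
    let _ := invertibleOfNonzero (inv_ne_zero hw0)
    rw [← eval₂_reverse_eq_zero_iff, invOf_eq_inv, inv_inv] at h1
    exact h1
  cases e with
  | zero =>
    have : NeZero (m : F p) := ⟨by rwa [Ne, CharP.cast_eq_zero_iff (F p) p]⟩
    have h1 := Polynomial.map_dvd (phi p) hprod
    rw [map_cyclotomic, pow_zero, one_mul, Polynomial.map_mul] at h1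
    have h2 : (X - C w) * (X - C w) ∣ cyclotomic m (F p) := by
      refine dvd_trans (mul_dvd_mul ?_ ?_) h1 <;> rw [dvd_iff_isRoot, IsRoot, eval_map] <;>
        assumption
    exact not_isUnit_X_sub_C w (squarefree_cyclotomic m (F p) _ h2)
  | succ e =>
    apply not_sq_dvd p hm w hprim e
    obtain ⟨c, hc⟩ := hprod
    rw [← map_cyclotomic _ (iota p), hc, eval_map, eval₂_mul, eval₂_mul]
    have hred : ∀ q : ℤ_[p][X], eval₂ (phi p) w q = 0 →
        (p : W p) ∣ eval₂ (iota p) (WittVector.teichmuller p w) q := by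
      intro q hq
      apply dvd_of_red
      rw [hom_eval₂, red_iota, red_teich, hq]
    rw [pow_two]
    exact Dvd.dvd.mul_right (mul_dvd_mul (hred _ hw') (hred _ hw)) _

lemma exists_factor {f : ℤ_[p][X]} (hf : f.Monic) {h : (ZMod p)[X]} (hirr : Irreducible h)
    (hd : h ∣ f.map PadicInt.toZMod) :
    ∃ k : ℤ_[p][X], k.Monic ∧ Irreducible k ∧ k ∣ f ∧ h ∣ k.map PadicInt.toZMod := by
  obtain ⟨s, hs, u, hu⟩ := WfDvdMonoid.exists_factors f hf.ne_zero
  have h1 : h ∣ (s.map (Polynomial.map PadicInt.toZMod)).prod := by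
    rw [← Polynomial.map_multiset_prod]
    have : s.prod = f * ((u⁻¹ : ℤ_[p][X]ˣ) : ℤ_[p][X]) := by rw [← hu]; simp
    rw [this, Polynomial.map_mul]
    exact Dvd.dvd.mul_right hd _
  obtain ⟨k, hk, hhk⟩ := hirr.prime.exists_mem_multiset_map_dvd h1
  have hkf : k ∣ f := by rw [← hu]; exact Dvd.dvd.mul_right (Multiset.dvd_prod hk) _
  obtain ⟨v, hv⟩ := hf.isUnit_leadingCoeff_of_dvd hkf
  have hCu : IsUnit (C ((v⁻¹ : ℤ_[p]ˣ) : ℤ_[p])) := (v⁻¹).isUnit.map C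
  refine ⟨C ((v⁻¹ : ℤ_[p]ˣ) : ℤ_[p]) * k, ?_, ?_, ?_, ?_⟩
  · rw [Monic, leadingCoeff_mul, leadingCoeff_C, ← hv]; simp
  · exact (irreducible_isUnit_mul hCu).2 (hs k hk)
  · exact hCu.mul_left_dvd.2 hkf
  · rw [Polynomial.map_mul]; exact Dvd.dvd.mul_left hhk _

lemma neg_one_of_symm {e m : ℕ} (hm : ¬ p ∣ m)
    {k : ℤ_[p][X]} (hk : k.Monic) (hirr : Irreducible k)
    (hdvd : k ∣ cyclotomic (p ^ e * m) ℤ_[p]) (hsym : k.reverse = C (k.eval 0) * k) :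
    ∃ r, (p : ZMod m) ^ r = -1 := by
  have hm0 : 0 < m := Nat.pos_of_ne_zero (by rintro rfl; simp at hm)
  have hn : 0 < p ^ e * m := Nat.mul_pos (pow_pos hp.out.pos e) hm0
  let K := FractionRing (W p)
  let L := AlgebraicClosure K
  let j : W p →+* L := (algebraMap K L).comp (algebraMap (W p) K)
  have hj : Function.Injective j := (algebraMap K L).injective.comp (IsFractionRing.injective _ _)
  let i : ℤ_[p] →+* L := j.comp (iota p)
  have hi : Function.Injective i := hj.comp (iota_injective p)
  let _ : Algebra ℤ_[p] L := i.toAlgebra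
  have : FaithfulSMul ℤ_[p] L := (faithfulSMul_iff_algebraMap_injective _ _).2 hi
  have : CharZero L := charZero_of_injective_algebraMap hi
  -- a root of k
  have hdeg : (k.map i).degree ≠ 0 := by
    rw [hk.degree_map]
    intro h
    exact hirr.not_isUnit
      (by rw [hk.natDegree_eq_zero.1 (natDegree_eq_of_degree_eq_some h)]; exact isUnit_one)
  obtain ⟨z, hz⟩ := IsAlgClosed.exists_root _ hdeg
  rw [IsRoot, eval_map] at hz
  have hzprim : IsPrimitiveRoot z (p ^ e * m) := by
    have : NeZero ((p ^ e * m : ℕ) : L) := ⟨by exact_mod_cast hn.ne'⟩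
    rw [← isRoot_cyclotomic_iff, IsRoot, ← map_cyclotomic _ i, eval_map]
    exact eval₂_eq_zero_of_dvd_of_eval₂_eq_zero _ _ hdvd hz
  have hz0 : z ≠ 0 := hzprim.ne_zero hn.ne'
  have hzinv : eval₂ i z⁻¹ k = 0 := by
    let _ := invertibleOfNonzero hz0
    rw [← eval₂_reverse_eq_zero_iff, invOf_eq_inv, hsym, eval₂_mul, eval₂_C, mul_eq_zero] at hz
    refine hz.resolve_left fun h => ?_
    have h0 : k.eval 0 = 0 := hi (by rw [h, map_zero])
    rw [h0, C_0, zero_mul, reverse_eq_zero] at hsym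
    exact hk.ne_zero hsym
  -- its p^e-th power comes from a Teichmuller representative
  have : NeZero m := ⟨hm0.ne'⟩
  have hmF : NeZero (m : F p) := ⟨by rwa [Ne, CharP.cast_eq_zero_iff (F p) p]⟩
  obtain ⟨w₀, hw₀⟩ : ∃ w : F p, IsPrimitiveRoot w m := HasEnoughRootsOfUnity.exists_primitiveRoot _ _
  have htinj : Function.Injective (WittVector.teichmuller p : F p → W p) :=
    fun a b hab => by rw [← red_teich p a, hab, red_teich]
  have hjt : IsPrimitiveRoot (j (WittVector.teichmuller p w₀)) m :=
    (hw₀.map_of_injective (f := WittVector.teichmuller p) htinj).map_of_injective hj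
  have hη : IsPrimitiveRoot (z ^ p ^ e) m := hzprim.pow hn rfl
  obtain ⟨a, -, ha⟩ := hjt.eq_pow_of_pow_eq_one hη.pow_eq_one
  set w := w₀ ^ a with hwdef
  have hjw : j (WittVector.teichmuller p w) = z ^ p ^ e := by
    rw [hwdef, map_pow, map_pow, ha]
  have hw : w ^ m = 1 := by rw [hwdef, ← pow_mul, mul_comm, pow_mul, hw₀.pow_eq_one, one_pow]
  set t := WittVector.teichmuller p w with ht
  -- the orbit polynomial descends
  set d := m.totient with hd
  have htd : t ^ p ^ d = t := by
    have h1 : p ^ d ≡ 1 [MOD m] :=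
      Nat.ModEq.pow_totient ((Nat.Prime.coprime_iff_not_dvd hp.out).2 hm)
    have h2 : w ^ p ^ d = w := by
      conv_rhs => rw [← pow_one w]
      exact pow_eq_pow_of_modEq h1 hw
    rw [ht, ← map_pow, h2]
  let G : (W p)[X] := ∏ s ∈ Finset.range d, (X - C (t ^ p ^ s))
  have hG : G.map WittVector.frobenius = G := by
    have hstep : ∀ s, WittVector.frobenius (t ^ p ^ s) = t ^ p ^ (s + 1) := by
      intro s
      rw [map_pow, ht, frob_teich, ← pow_mul, pow_succ']
    simp only [G, Polynomial.map_prod, Polynomial.map_sub, map_X, map_C, hstep]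
    have h1 := Finset.prod_range_succ (fun s => (X - C (t ^ p ^ s) : (W p)[X])) d
    rw [Finset.prod_range_succ'] at h1
    simp only [htd, pow_zero, pow_one] at h1
    exact mul_right_cancel₀ (X_sub_C_ne_zero t) h1
  obtain ⟨g, hg⟩ : ∃ g : ℤ_[p][X], g.map (iota p) = G := by
    have : G ∈ lifts (iota p) := by
      rw [lifts_iff_coeff_lifts]
      intro n
      apply mem_range_of_frob
      rw [← coeff_map, hG]
    rwa [mem_lifts] at this
  have hgeval : ∀ x : L, eval₂ i x g = ∏ s ∈ Finset.range d, (x - j (t ^ p ^ s)) := by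
    intro x
    rw [show i = j.comp (iota p) from rfl, ← eval₂_map, hg, eval₂_finsetProd]
    refine Finset.prod_congr rfl fun s _ => ?_
    rw [eval₂_sub, eval₂_X, eval₂_C]
  have hint : IsIntegral ℤ_[p] z := ⟨k, hk, hz⟩
  have hkmin : minpoly ℤ_[p] z ∣ k := minpoly.isIntegrallyClosed_dvd hint hz
  have hmk : k ∣ minpoly ℤ_[p] z :=
    ((minpoly.prime_of_isIntegrallyClosed hint).irreducible.associated_of_dvd hirr hkmin).symm.dvd
  have hd0 : 0 < d := Nat.totient_pos.2 hm0
  have hgz : aeval z (expand ℤ_[p] (p ^ e) g) = 0 := by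
    rw [expand_aeval, aeval_def]
    change eval₂ i _ g = 0
    rw [hgeval]
    apply Finset.prod_eq_zero (Finset.mem_range.2 hd0)
    rw [pow_zero, pow_one, hjw, sub_self]
  have hkg : k ∣ expand ℤ_[p] (p ^ e) g := hmk.trans (minpoly.isIntegrallyClosed_dvd hint hgz)
  have hfin : aeval z⁻¹ (expand ℤ_[p] (p ^ e) g) = 0 :=
    eval₂_eq_zero_of_dvd_of_eval₂_eq_zero _ _ hkg hzinv
  rw [expand_aeval, aeval_def] at hfin
  change eval₂ i _ g = 0 at hfin
  rw [hgeval, Finset.prod_eq_zero_iff] at hfin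
  obtain ⟨r, -, hr⟩ := hfin
  refine ⟨r, ?_⟩
  rw [sub_eq_zero, map_pow, hjw, inv_pow] at hr
  have h1 : (z ^ p ^ e) ^ (p ^ r + 1) = 1 := by
    rw [pow_succ, ← hr, inv_mul_cancel₀ (pow_ne_zero _ hz0)]
  rw [hη.pow_eq_one_iff_dvd, ← ZMod.natCast_eq_zero_iff] at h1
  push_cast at h1
  exact eq_neg_of_add_eq_zero_left h1

lemma dvd_cyclo_iff {e m : ℕ} (hm : ¬ p ∣ m) {h : (ZMod p)[X]} (hirr : Irreducible h) :
    h ∣ cyclotomic (p ^ e * m) (ZMod p) ↔ h ∣ cyclotomic m (ZMod p) := by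
  cases e with
  | zero => simp
  | succ e =>
    rw [cyclotomic_mul_prime_pow_eq (ZMod p) hm (Nat.succ_pos e)]
    refine hirr.prime.dvd_pow_iff_dvd ?_
    rw [Nat.sub_ne_zero_iff_lt]
    exact Nat.pow_lt_pow_right hp.out.one_lt (by omega)

lemma main_pos {e m : ℕ} (hm : ¬ p ∣ m) (hr : ∃ r : ℕ, (p : ZMod m) ^ r = -1) :
    IbarSet p (cyclotomic (p ^ e * m) ℤ) = {h : (ZMod p)[X] | h.Monic ∧ Irreducible h ∧
      h ∣ cyclotomic m (ZMod p)} := by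
  obtain ⟨r, hr⟩ := hr
  ext h
  simp only [IbarSet, Set.mem_ofPred_eq, map_cyclotomic]
  refine and_congr_right fun hmon => and_congr_right fun hirr => ⟨?_, ?_⟩
  · rintro ⟨k, -, -, -, hk, hd⟩
    rw [← dvd_cyclo_iff p hm hirr (e := e)]
    have := Polynomial.map_dvd PadicInt.toZMod hk
    rw [map_cyclotomic] at this
    exact hd.trans this
  · intro hd
    rw [← dvd_cyclo_iff p hm hirr (e := e), ← map_cyclotomic _ PadicInt.toZMod] at hd
    obtain ⟨k, h1, h2, h3, h4⟩ := exists_factor p (cyclotomic.monic _ _) hirr hd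
    exact ⟨k, h1, h2, symm_of_neg_one p hm hr h1 h2 h3, h3, h4⟩

lemma main_lin {q : (ZMod p)[X]} (hq : q.Monic) (hi : Irreducible q) :
    {h : (ZMod p)[X] | h.Monic ∧ Irreducible h ∧ h ∣ q} = {q} := by
  ext h
  simp only [Set.mem_ofPred_eq, Set.mem_singleton_iff]
  constructor
  · rintro ⟨h1, h2, h3⟩
    exact eq_of_monic_of_associated h1 hq (h2.associated_of_dvd hi h3)
  · rintro rfl
    exact ⟨hq, hi, dvd_rfl⟩

lemma case_one (e : ℕ) : IbarSet p (cyclotomic (p ^ e) ℤ) = {(X - 1 : (ZMod p)[X])} := by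
  have h := main_pos p (e := e) (m := 1) (by simpa using hp.out.one_lt.ne')
    ⟨0, Subsingleton.elim _ _⟩
  rw [mul_one, cyclotomic_one] at h
  rw [h]
  exact main_lin p (by simpa using monic_X_sub_C (1 : ZMod p))
    (by simpa using irreducible_X_sub_C (1 : ZMod p))

lemma case_two (e : ℕ) : IbarSet p (cyclotomic (2 * p ^ e) ℤ) = {(X + 1 : (ZMod p)[X])} := by
  by_cases h2 : p = 2
  · subst h2
    rw [← pow_succ', case_one]
    congr 1
    have : (C (-1 : ZMod 2) : (ZMod 2)[X]) = C 1 := congrArg C (ZMod.neg_eq_self_mod_two 1)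
    rw [C_neg, C_1] at this
    rw [sub_eq_add_neg, this]
  · have h := main_pos p (e := e) (m := 2)
      (fun hd => h2 ((Nat.prime_dvd_prime_iff_eq hp.out Nat.prime_two).1 hd)) ⟨0, by rw [pow_zero]; decide⟩
    rw [mul_comm, cyclotomic_two] at h
    rw [h]
    exact main_lin p (by simpa using monic_X_add_C (1 : ZMod p))
      (by simpa using irreducible_X_sub_C (-1 : ZMod p))

end IbarAux

/-- Description of `Ī(Φ_n;ℚ_p)`: (i) if `n = p^e` it is `{X-1}`; (ii) if `n = 2p^e` it is
`{X+1}`; (iii) if `n = p^e·m` with `m ≥ 3` and `p ∤ m`, it is the set of monic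
irreducible factors of `Φ_m mod p` when `p^r ≡ -1 (mod m)` for some `r`, and empty
otherwise. -/
theorem ibarSet_cyclotomic (p n : ℕ) [Fact p.Prime] (hn : 0 < n) :
    ((∃ e : ℕ, n = p ^ e) →
      IbarSet p (Polynomial.cyclotomic n ℤ) = {(X - 1 : Polynomial (ZMod p))}) ∧
    ((∃ e : ℕ, n = 2 * p ^ e) →
      IbarSet p (Polynomial.cyclotomic n ℤ) = {(X + 1 : Polynomial (ZMod p))}) ∧
    (∀ e m : ℕ, 3 ≤ m → ¬ p ∣ m → n = p ^ e * m →
      ((∃ r : ℕ, (p : ZMod m) ^ r = -1) →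
        IbarSet p (Polynomial.cyclotomic n ℤ) =
          {h : Polynomial (ZMod p) | h.Monic ∧ Irreducible h ∧
            h ∣ (Polynomial.cyclotomic m ℤ).map (Int.castRingHom (ZMod p))}) ∧
      (¬ (∃ r : ℕ, (p : ZMod m) ^ r = -1) →
        IbarSet p (Polynomial.cyclotomic n ℤ) = ∅)) := by
  refine ⟨?_, ?_, ?_⟩
  · rintro ⟨e, rfl⟩
    exact IbarAux.case_one p e
  · rintro ⟨e, rfl⟩
    exact IbarAux.case_two p e
  · rintro e m - hm rfl
    refine ⟨fun hr => ?_, fun hr => ?_⟩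
    · rw [map_cyclotomic]
      exact IbarAux.main_pos p hm hr
    · rw [Set.eq_empty_iff_forall_notMem]
      rintro h ⟨-, -, k, h1, h2, h3, h4, -⟩
      rw [map_cyclotomic] at h4
      exact hr (IbarAux.neg_one_of_symm p hm h1 h2 h4 h3)
end

section
/- Let n > n' ≥ 1 be positive integers. (i) If there is no prime p and integer k ≥ 1 with n = p^k·n', then Π(Φ_n, Φ_{n'}) = ∅. (ii) If n = p^k·n' for a prime p and an integer k ≥ 1, write n = p^e·m with e ≥ 0 and p ∤ m; then Π(Φ_n, Φ_{n'}) = {p} if there exists an integer r ≥ 0 with p^r ≡ −1 (mod m), and Π(Φ_n, Φ_{n'}) = ∅ otherwise. -/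
open Polynomial

/-- `Π(f,g)`: the set of primes `p` such that `Ī(f;ℚ_p) ∩ Ī(g;ℚ_p) ≠ ∅`. -/
def PiSet (f g : Polynomial ℤ) : Set ℕ :=
  {p | ∃ hp : Fact p.Prime, ((@IbarSet p hp f) ∩ (@IbarSet p hp g)).Nonempty}

theorem aux_isAdicComplete (p : ℕ) [Fact p.Prime] (k : ℤ_[p][X]) (hk : k.Monic) :
    IsAdicComplete (Ideal.span {(p : AdjoinRoot k)}) (AdjoinRoot k) := by
  let b := (AdjoinRoot.powerBasis' hk).basis
  have key : ∀ (n : ℕ) (x : AdjoinRoot k),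
      x ∈ (Ideal.span {(p : AdjoinRoot k)} ^ n • (⊤ : Submodule (AdjoinRoot k) (AdjoinRoot k))) ↔
        ∀ i, b.repr x i ∈ Ideal.span {(p : ℤ_[p]) ^ n} := by
    intro n x
    rw [Ideal.span_singleton_pow, smul_eq_mul, Ideal.mul_top, Ideal.mem_span_singleton]
    constructor
    · rintro ⟨y, rfl⟩ i
      have : (p : AdjoinRoot k) ^ n * y = ((p : ℤ_[p]) ^ n) • y := by
        rw [Algebra.smul_def]; simp
      rw [this, map_smul, Ideal.mem_span_singleton]
      simp
    · intro h
      choose c hc using fun i => Ideal.mem_span_singleton.mp (h i)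
      refine ⟨∑ i, c i • b i, ?_⟩
      have : (p : AdjoinRoot k) ^ n * (∑ i, c i • b i) = ((p : ℤ_[p]) ^ n) • (∑ i, c i • b i) := by
        rw [Algebra.smul_def]; simp
      rw [this, Finset.smul_sum]
      conv_lhs => rw [← b.sum_repr x]
      refine Finset.sum_congr rfl fun i _ => ?_
      rw [hc, smul_smul]
  have hZ : IsAdicComplete (Ideal.span {(p : ℤ_[p])}) ℤ_[p] := by
    rw [← PadicInt.maximalIdeal_eq_span_p]; infer_instance
  have hsm : ∀ (n : ℕ) (x : ℤ_[p]),
      x ∈ (Ideal.span {(p : ℤ_[p])} ^ n • (⊤ : Submodule ℤ_[p] ℤ_[p])) ↔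
        x ∈ Ideal.span {(p : ℤ_[p]) ^ n} := by
    intro n x
    rw [Ideal.span_singleton_pow, smul_eq_mul, Ideal.mul_top]
  refine { haus' := ?_, prec' := ?_ }
  · intro x hx
    apply b.repr.injective
    ext i
    rw [map_zero, Finsupp.zero_apply]
    apply hZ.toIsHausdorff.haus'
    intro n
    have := hx n
    rw [SModEq.sub_mem, sub_zero, key] at this
    rw [SModEq.sub_mem, sub_zero, hsm]
    exact this i
  · intro f hf
    have : ∀ i, ∃ L : ℤ_[p], ∀ n, b.repr (f n) i ≡ L
        [SMOD (Ideal.span {(p : ℤ_[p])} ^ n • (⊤ : Submodule ℤ_[p] ℤ_[p]))] := by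
      intro i
      apply hZ.toIsPrecomplete.prec'
      intro m n hmn
      have := hf hmn
      rw [SModEq.sub_mem, key] at this
      rw [SModEq.sub_mem, hsm]
      simpa using this i
    choose L hL using this
    refine ⟨∑ i, L i • b i, fun n => ?_⟩
    rw [SModEq.sub_mem, key]
    intro i
    have := hL i n
    rw [SModEq.sub_mem, hsm] at this
    rw [map_sub, Finsupp.sub_apply, b.repr_sum_self]
    exact this

theorem aux_map_eq_zero (p : ℕ) [Fact p.Prime] (g : ℤ_[p][X])
    (hg : g.map (PadicInt.toZMod : ℤ_[p] →+* ZMod p) = 0) : C (p : ℤ_[p]) ∣ g := by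
  rw [C_dvd_iff_dvd_coeff]
  intro i
  have : PadicInt.toZMod (g.coeff i) = 0 := by rw [← coeff_map, hg, coeff_zero]
  rw [← RingHom.mem_ker, PadicInt.ker_toZMod, PadicInt.maximalIdeal_eq_span_p,
    Ideal.mem_span_singleton] at this
  exact this

theorem aux_toZMod_surj (p : ℕ) [Fact p.Prime] :
    Function.Surjective (PadicInt.toZMod : ℤ_[p] →+* ZMod p) :=
  ZMod.ringHom_surjective _

theorem aux_mem_iff (p : ℕ) [Fact p.Prime] (k g : ℤ_[p][X]) :
    AdjoinRoot.mk k g ∈ Ideal.span {(p : AdjoinRoot k)} ↔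
      k.map (PadicInt.toZMod : ℤ_[p] →+* ZMod p) ∣ g.map PadicInt.toZMod := by
  rw [Ideal.mem_span_singleton]
  have hp : ∀ s : ℤ_[p][X], (p : AdjoinRoot k) * AdjoinRoot.mk k s
      = AdjoinRoot.mk k (C (p : ℤ_[p]) * s) := by
    intro s; simp
  constructor
  · rintro ⟨y, hy⟩
    obtain ⟨s, rfl⟩ := AdjoinRoot.mk_surjective y
    rw [hp, AdjoinRoot.mk_eq_mk] at hy
    have := Polynomial.map_dvd (PadicInt.toZMod : ℤ_[p] →+* ZMod p) hy
    simpa using this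
  · rintro ⟨t, ht⟩
    obtain ⟨t, rfl⟩ := Polynomial.map_surjective _ (aux_toZMod_surj p) t
    obtain ⟨s, hs⟩ := aux_map_eq_zero p (g - k * t) (by simp [ht])
    refine ⟨AdjoinRoot.mk k s, ?_⟩
    rw [hp, AdjoinRoot.mk_eq_mk, ← hs]
    exact ⟨t, by ring⟩

theorem aux_hensel (p : ℕ) [Fact p.Prime] (k : ℤ_[p][X]) (hk : k.Monic) (hi : Irreducible k)
    (a b : (ZMod p)[X]) (hab : k.map (PadicInt.toZMod : ℤ_[p] →+* ZMod p) = a * b)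
    (hc : IsCoprime a b) : IsUnit a ∨ IsUnit b := by
  have : IsDomain (AdjoinRoot k) := AdjoinRoot.isDomain_of_prime hi.prime
  have := aux_isAdicComplete p k hk
  obtain ⟨u, v, huv⟩ := hc
  have hk0 : a * b ≠ 0 := by rw [← hab]; exact (hk.map _).ne_zero
  obtain ⟨ha0, hb0⟩ := mul_ne_zero_iff.mp hk0
  obtain ⟨g, hg⟩ := Polynomial.map_surjective _ (aux_toZMod_surj p) (u * a)
  set I := Ideal.span {(p : AdjoinRoot k)} with hI
  set e := AdjoinRoot.mk k g with he
  have h1 : e ^ 2 - e ∈ I := by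
    rw [he, ← map_pow, ← map_sub, aux_mem_iff, Polynomial.map_sub, Polynomial.map_pow, hg, hab]
    refine ⟨-(u * v), ?_⟩
    have hv : v * b = 1 - u * a := by rw [← huv]; ring
    linear_combination (u * a) * hv
  obtain ⟨c, hc1, hc2⟩ := HenselianRing.is_henselian (I := I) (X ^ 2 - X : (AdjoinRoot k)[X])
    (by monicity!) e (by simpa using h1) (by
      apply IsUnit.of_mul_eq_one (Ideal.Quotient.mk I (2 * e - 1))
      rw [← map_mul, ← map_one (Ideal.Quotient.mk I), Ideal.Quotient.eq]
      simp only [derivative_sub, derivative_X_pow, derivative_X, eval_sub, eval_mul, eval_pow,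
        eval_X, eval_one, eval_C]
      have := I.mul_mem_left 4 h1
      convert this using 1
      push_cast
      ring)
  have hc3 : c * (c - 1) = 0 := by
    have : c ^ 2 - c = 0 := by simpa using hc1
    linear_combination this
  rcases mul_eq_zero.mp hc3 with h | h
  · right
    have : e ∈ I := by
      rw [h, zero_sub] at hc2
      exact neg_mem_iff.mp hc2
    rw [he, aux_mem_iff, hg, hab, mul_comm u a, mul_dvd_mul_iff_left ha0] at this
    refine isUnit_of_dvd_one ?_
    rw [← huv]
    exact dvd_add (this.mul_right _) (dvd_mul_left _ _)
  · left
    have : 1 - e ∈ I := by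
      rwa [sub_eq_zero.mp h] at hc2
    rw [he, ← map_one (AdjoinRoot.mk k), ← map_sub, aux_mem_iff, Polynomial.map_sub, hg, hab,
      Polynomial.map_one, ← huv, add_sub_cancel_left, mul_dvd_mul_iff_right hb0] at this
    refine isUnit_of_dvd_one ?_
    rw [← huv]
    exact dvd_add (dvd_mul_left _ _) (this.mul_right _)

theorem aux_pow (p : ℕ) [Fact p.Prime] (k : ℤ_[p][X]) (hk : k.Monic) (hi : Irreducible k)
    (h : (ZMod p)[X]) (hm : h.Monic) (hirr : Irreducible h)
    (hd : h ∣ k.map (PadicInt.toZMod : ℤ_[p] →+* ZMod p)) :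
    ∃ j : ℕ, k.map (PadicInt.toZMod : ℤ_[p] →+* ZMod p) = h ^ j := by
  have hk0 : k.map (PadicInt.toZMod : ℤ_[p] →+* ZMod p) ≠ 0 := (hk.map _).ne_zero
  have hfin : FiniteMultiplicity h (k.map (PadicInt.toZMod : ℤ_[p] →+* ZMod p)) :=
    FiniteMultiplicity.of_not_isUnit hirr.not_isUnit hk0
  obtain ⟨c, hc, hnc⟩ := hfin.exists_eq_pow_mul_and_not_dvd
  set j := multiplicity h (k.map (PadicInt.toZMod : ℤ_[p] →+* ZMod p))
  refine ⟨j, ?_⟩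
  have hcop : IsCoprime (h ^ j) c := (hirr.coprime_iff_not_dvd.mpr hnc).pow_left
  rcases aux_hensel p k hk hi _ _ hc hcop with hu | hu
  · exfalso
    apply hnc
    rw [hc] at hd
    exact (hu.dvd_mul_left).mp hd
  · refine eq_of_monic_of_associated (hk.map _) (hm.pow _) ?_
    rw [hc]
    exact associated_mul_unit_left _ _ hu

theorem aux_cyc (p : ℕ) [Fact p.Prime] (e m : ℕ) (hm : ¬ p ∣ m) :
    cyclotomic (p ^ e * m) (ZMod p) = cyclotomic m (ZMod p) ^ (Nat.totient (p ^ e)) := by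
  rcases e with _ | e
  · simp
  · rw [cyclotomic_mul_prime_pow_eq (ZMod p) hm (Nat.succ_pos e),
      Nat.totient_prime_pow_succ (Fact.out), Nat.mul_sub, mul_one, pow_succ]
    simp

theorem aux_map_cyc (p : ℕ) [Fact p.Prime] (n : ℕ) :
    (cyclotomic n ℤ_[p]).map (PadicInt.toZMod : ℤ_[p] →+* ZMod p) = cyclotomic n (ZMod p) :=
  map_cyclotomic _ _

theorem aux_prim (p : ℕ) [Fact p.Prime] (e m : ℕ) (hm : ¬ p ∣ m) (h : (ZMod p)[X])
    [Fact (Irreducible h)] (hd : h ∣ cyclotomic (p ^ e * m) (ZMod p)) :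
    IsPrimitiveRoot (AdjoinRoot.root h) m := by
  have : CharP (AdjoinRoot h) p := charP_of_injective_algebraMap (algebraMap (ZMod p) _).injective p
  have : NeZero (m : AdjoinRoot h) := ⟨by rwa [Ne, CharP.cast_eq_zero_iff (AdjoinRoot h) p]⟩
  rw [← isRoot_cyclotomic_prime_pow_mul_iff_of_charP (p := p) (k := e), IsRoot.def,
    ← map_cyclotomic _ (AdjoinRoot.of h), eval_map]
  obtain ⟨c, hc⟩ := hd
  rw [hc, eval₂_mul, AdjoinRoot.eval₂_root, zero_mul]

theorem aux_A (p : ℕ) [Fact p.Prime] (e m : ℕ) (hm : ¬ p ∣ m) (k : ℤ_[p][X]) (hk : k.Monic)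
    (hi : Irreducible k) (hs : k.reverse = C (k.eval 0) * k)
    (hkd : k ∣ (cyclotomic (p ^ e * m) ℤ).map (Int.castRingHom ℤ_[p]))
    (h : (ZMod p)[X]) (hmon : h.Monic) (hirr : Irreducible h)
    (hd : h ∣ k.map (PadicInt.toZMod : ℤ_[p] →+* ZMod p)) :
    ∃ r : ℕ, (p : ZMod m) ^ r = -1 := by
  have hF : Fact (Irreducible h) := ⟨hirr⟩
  rw [map_cyclotomic] at hkd
  have hdc : h ∣ cyclotomic (p ^ e * m) (ZMod p) := by
    rw [← aux_map_cyc]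
    exact hd.trans (Polynomial.map_dvd _ hkd)
  have hprim := aux_prim p e m hm h hdc
  set α := AdjoinRoot.root h with hα
  have hm0 : m ≠ 0 := by rintro rfl; simp at hm
  have hα0 : α ≠ 0 := hprim.ne_zero hm0
  let i : ℤ_[p] →+* AdjoinRoot h := (AdjoinRoot.of h).comp PadicInt.toZMod
  have hroot : eval₂ i α k = 0 := by
    rw [← eval₂_map]
    obtain ⟨c, hc⟩ := hd
    rw [hc, eval₂_mul, AdjoinRoot.eval₂_root, zero_mul]
  obtain ⟨j, hj⟩ := aux_pow p k hk hi h hmon hirr hd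
  have h1 : k.eval 0 * k.eval 0 = 1 := by
    have := congrArg (fun f => coeff f 0) hs
    simp only [coeff_zero_reverse, coeff_C_mul, hk.leadingCoeff] at this
    rw [← coeff_zero_eq_eval_zero] at this ⊢
    exact this.symm
  have h2 : eval₂ i α⁻¹ k = 0 := by
    let hinv : Invertible α⁻¹ := ⟨α, mul_inv_cancel₀ hα0, inv_mul_cancel₀ hα0⟩
    have := (eval₂_reverse_eq_zero_iff i α⁻¹ k)
    have hinv2 : ⅟α⁻¹ = α := rfl
    rw [hinv2, hs, eval₂_mul, hroot, mul_zero] at this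
    exact this.mp rfl
  rw [← eval₂_map, hj, eval₂_pow] at h2
  have h3 := eq_zero_of_pow_eq_zero h2
  have : Module.Finite (ZMod p) (AdjoinRoot h) := hmon.finite_adjoinRoot
  have : Finite (AdjoinRoot h) := Module.finite_of_finite (ZMod p)
  let σ : AdjoinRoot h →ₐ[ZMod p] AdjoinRoot h := AdjoinRoot.liftAlgHom h (Algebra.ofId _ _) α⁻¹ h3
  obtain ⟨r, hr⟩ := (FiniteField.bijective_frobeniusAlgHom_pow (ZMod p) (AdjoinRoot h)).2 σ
  refine ⟨r, ?_⟩
  have h4 : α ^ (p ^ (r : ℕ)) = α⁻¹ := by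
    have := congrArg (fun f => f α) hr
    simpa [σ, AlgHom.coe_pow, FiniteField.coe_frobeniusAlgHom, pow_iterate, hα] using this
  have h5 : α ^ (p ^ (r : ℕ) + 1) = 1 := by
    rw [pow_succ, h4, inv_mul_cancel₀ hα0]
  have h6 := (ZMod.natCast_eq_zero_iff _ _).mpr (hprim.dvd_of_pow_eq_one _ h5)
  push_cast at h6
  exact eq_neg_of_add_eq_zero_left h6

theorem aux_exists (p : ℕ) [Fact p.Prime] (h : (ZMod p)[X]) (hirr : Irreducible h) :
    ∀ (d : ℕ) (F : ℤ_[p][X]), F.Monic → F.natDegree = d →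
      h ∣ F.map (PadicInt.toZMod : ℤ_[p] →+* ZMod p) →
      ∃ k : ℤ_[p][X], k.Monic ∧ Irreducible k ∧ k ∣ F ∧
        h ∣ k.map (PadicInt.toZMod : ℤ_[p] →+* ZMod p) := by
  intro d
  induction d using Nat.strong_induction_on with
  | _ d ih =>
    intro F hF hdeg hd
    by_cases hirrF : Irreducible F
    · exact ⟨F, hF, hirrF, dvd_rfl, hd⟩
    · have hF1 : F ≠ 1 := by
        rintro rfl
        rw [Polynomial.map_one] at hd
        exact hirr.not_isUnit (isUnit_of_dvd_one hd)
      rw [irreducible_of_monic hF hF1] at hirrF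
      push Not at hirrF
      obtain ⟨f, g, hf, hg, hfg, hf1, hg1⟩ := hirrF
      have hf2 : 0 < f.natDegree := Nat.pos_of_ne_zero fun h0 => hf1 (hf.natDegree_eq_zero.mp h0)
      have hg2 : 0 < g.natDegree := Nat.pos_of_ne_zero fun h0 => hg1 (hg.natDegree_eq_zero.mp h0)
      have hsum : f.natDegree + g.natDegree = d := by rw [← hdeg, ← hfg, hf.natDegree_mul hg]
      rw [← hfg, Polynomial.map_mul] at hd
      rcases hirr.prime.dvd_or_dvd hd with h' | h'
      · obtain ⟨k, h1, h2, h3, h4⟩ := ih f.natDegree (by omega) f hf rfl h'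
        exact ⟨k, h1, h2, h3.trans ⟨g, hfg.symm⟩, h4⟩
      · obtain ⟨k, h1, h2, h3, h4⟩ := ih g.natDegree (by omega) g hg rfl h'
        exact ⟨k, h1, h2, h3.trans ⟨f, by rw [mul_comm, hfg]⟩, h4⟩

theorem aux_le (p : ℕ) [Fact p.Prime] (e m : ℕ) (hm : ¬ p ∣ m) (k : ℤ_[p][X]) (hk : k.Monic)
    (hi : Irreducible k) (hch : CharZero (AdjoinRoot k))
    (hx : IsPrimitiveRoot (AdjoinRoot.root k) (p ^ e * m))
    (h : (ZMod p)[X]) (hirr : Irreducible h) [Fact (Irreducible h)]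
    (hprim : IsPrimitiveRoot (AdjoinRoot.root h) m) (j : ℕ)
    (hj : k.map (PadicInt.toZMod : ℤ_[p] →+* ZMod p) = h ^ j) (hj0 : j ≠ 0)
    (θ : AdjoinRoot k →+* AdjoinRoot h)
    (hθ : θ.comp (AdjoinRoot.of k) = (AdjoinRoot.of h).comp PadicInt.toZMod)
    (hθx : θ (AdjoinRoot.root k) = AdjoinRoot.root h) :
    Nat.totient (p ^ e) ≤ j := by
  have hdom : IsDomain (AdjoinRoot k) := AdjoinRoot.isDomain_of_prime hi.prime
  have hm0 : m ≠ 0 := by rintro rfl; simp at hm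
  have hp : p.Prime := Fact.out
  rcases e with _ | e
  · simp; omega
  by_contra hlt
  push Not at hlt
  set f := Nat.totient (p ^ (e + 1)) with hf
  have hdiv : h ∣ X ^ m - 1 := by
    rw [← AdjoinRoot.mk_eq_zero]
    simp [hprim.pow_eq_one]
  have h1 : k.map (PadicInt.toZMod : ℤ_[p] →+* ZMod p) ∣
      ((X ^ m - 1) ^ (f - 1) : ℤ_[p][X]).map PadicInt.toZMod := by
    rw [hj]
    simp only [Polynomial.map_pow, Polynomial.map_sub, Polynomial.map_X, Polynomial.map_one]
    exact (pow_dvd_pow h (by omega : j ≤ f - 1)).trans (pow_dvd_pow_of_dvd hdiv _)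
  rw [← aux_mem_iff, Ideal.mem_span_singleton] at h1
  obtain ⟨r, hr⟩ := h1
  simp only [map_pow, map_sub, AdjoinRoot.mk_X, map_one] at hr
  set ζ := AdjoinRoot.root k ^ m with hζ
  have hζp : IsPrimitiveRoot ζ (p ^ (e + 1)) :=
    hx.pow (by have := hp.pos; positivity) (mul_comm _ _)
  obtain ⟨g, hg⟩ := aux_map_eq_zero p (cyclotomic (p ^ (e + 1)) ℤ_[p] - (X - 1) ^ f) (by
    rw [Polynomial.map_sub, aux_map_cyc]
    have := aux_cyc p (e + 1) 1 (by simpa using hp.one_lt.ne')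
    rw [mul_one, cyclotomic_one] at this
    rw [this]
    simp [hf])
  have hfpos : 0 < f := Nat.totient_pos.mpr (pow_pos hp.pos _)
  have hpp : (p : ℤ_[p]) ≠ 0 := Nat.cast_ne_zero.mpr hp.ne_zero
  have hg1 : g.eval 1 = 1 := by
    have := congrArg (eval 1) hg
    simp only [eval_sub, eval_one_cyclotomic_prime_pow, eval_pow, eval_X, eval_one, sub_self,
      zero_pow hfpos.ne', sub_zero, eval_mul, eval_C] at this
    exact mul_left_cancel₀ hpp (by rw [← this, mul_one])
  have hgz : (p : AdjoinRoot k) * eval₂ (AdjoinRoot.of k) ζ g = - (ζ - 1) ^ f := by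
    have := congrArg (eval₂ (AdjoinRoot.of k) ζ) hg
    have hc : eval₂ (AdjoinRoot.of k) ζ (cyclotomic (p ^ (e + 1)) ℤ_[p]) = 0 := by
      rw [← eval_map, map_cyclotomic]
      exact hζp.isRoot_cyclotomic (pow_pos hp.pos _)
    simp only [eval₂_sub, hc, eval₂_pow, eval₂_X, eval₂_one, eval₂_mul, map_natCast,
      zero_sub, eval₂_natCast] at this
    exact this.symm
  have hgz2 : eval₂ (AdjoinRoot.of k) ζ g = -(r * (ζ - 1)) := by
    have hp0 : (p : AdjoinRoot k) ≠ 0 := Nat.cast_ne_zero.mpr hp.ne_zero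
    apply mul_left_cancel₀ hp0
    rw [hgz]
    obtain ⟨f', hf'⟩ : ∃ f', f = f' + 1 := ⟨f - 1, by omega⟩
    rw [hf', Nat.add_sub_cancel] at hr
    rw [hf', pow_succ, hr]
    ring
  have hfin := congrArg θ hgz2
  have hθζ : θ ζ = 1 := by rw [hζ, map_pow, hθx, hprim.pow_eq_one]
  rw [hom_eval₂, hθζ, hθ, map_neg, map_mul, map_sub, hθζ, map_one, sub_self, mul_zero,
    neg_zero, ← map_one ((AdjoinRoot.of h).comp (PadicInt.toZMod : ℤ_[p] →+* ZMod p)),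
    eval₂_at_apply, hg1, map_one] at hfin
  exact one_ne_zero hfin

theorem aux_symm_of_root (p : ℕ) [Fact p.Prime] (k : ℤ_[p][X]) (hk : k.Monic)
    (y : AdjoinRoot k) (hxy : y * AdjoinRoot.root k = 1)
    (hy : eval₂ (AdjoinRoot.of k) y k = 0) :
    k.reverse = C (k.eval 0) * k := by
  let hinv : Invertible y := ⟨AdjoinRoot.root k, by rw [mul_comm, hxy], hxy⟩
  have h1 := eval₂_reverse_mul_pow (AdjoinRoot.of k) y k
  have h2 : ⅟y = AdjoinRoot.root k := rfl
  rw [hy, h2] at h1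
  have h3 : AdjoinRoot.mk k k.reverse = 0 := by
    rw [← AdjoinRoot.aeval_eq, aeval_def]
    have := congrArg (· * (AdjoinRoot.root k) ^ k.natDegree) h1
    simp only [mul_assoc, ← mul_pow, hxy, one_pow, mul_one, zero_mul] at this
    exact this
  rw [AdjoinRoot.mk_eq_zero] at h3
  obtain ⟨c, hc⟩ := h3
  have hc0 : c ≠ 0 := by
    rintro rfl
    rw [mul_zero, reverse_eq_zero] at hc
    exact hk.ne_zero hc
  have hdeg : c.natDegree = 0 := by
    have := reverse_natDegree_le k
    rw [hc, hk.natDegree_mul' hc0] at this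
    omega
  rw [eq_C_of_natDegree_eq_zero hdeg] at hc
  have h4 := congrArg (fun f => coeff f k.natDegree) hc
  simp only [coeff_reverse, coeff_mul_C, revAt_le le_rfl, Nat.sub_self, coeff_natDegree,
    hk.leadingCoeff, one_mul] at h4
  rw [hc, ← h4, coeff_zero_eq_eval_zero, mul_comm]

theorem aux_B (p : ℕ) [Fact p.Prime] (e m : ℕ) (hm : ¬ p ∣ m)
    (hr : ∃ r : ℕ, (p : ZMod m) ^ r = -1) (h : (ZMod p)[X]) (hmon : h.Monic) (hirr : Irreducible h)
    (hdm : h ∣ cyclotomic m (ZMod p)) :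
    h ∈ IbarSet p (cyclotomic (p ^ e * m) ℤ) := by
  have hF : Fact (Irreducible h) := ⟨hirr⟩
  have hp : p.Prime := Fact.out
  have hm0 : m ≠ 0 := by rintro rfl; simp at hm
  have hN : 0 < p ^ e * m := by have := hp.pos; positivity
  have hfpos : 0 < Nat.totient (p ^ e) := Nat.totient_pos.mpr (pow_pos hp.pos _)
  have hdN : h ∣ (cyclotomic (p ^ e * m) ℤ_[p]).map (PadicInt.toZMod : ℤ_[p] →+* ZMod p) := by
    rw [aux_map_cyc, aux_cyc p e m hm]
    exact dvd_pow hdm hfpos.ne'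
  obtain ⟨k, hk, hi, hkd, hd⟩ := aux_exists p h hirr _ _ (cyclotomic.monic _ _) rfl hdN
  refine ⟨hmon, hirr, k, hk, hi, ?_, by rwa [map_cyclotomic], hd⟩
  have hprim := aux_prim p 0 m hm h (by simpa using hdm)
  obtain ⟨j, hj⟩ := aux_pow p k hk hi h hmon hirr hd
  have hj0 : j ≠ 0 := by
    rintro rfl
    rw [hj, pow_zero] at hd
    exact hirr.not_isUnit (isUnit_of_dvd_one hd)
  let i : ℤ_[p] →+* AdjoinRoot h := (AdjoinRoot.of h).comp PadicInt.toZMod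
  have hroot : eval₂ i (AdjoinRoot.root h) k = 0 := by
    rw [← eval₂_map]
    obtain ⟨c, hc⟩ := hd
    rw [hc, eval₂_mul, AdjoinRoot.eval₂_root, zero_mul]
  let θ : AdjoinRoot k →+* AdjoinRoot h := AdjoinRoot.lift i (AdjoinRoot.root h) hroot
  have hθ : θ.comp (AdjoinRoot.of k) = i := by ext x; simp [θ]
  have hθx : θ (AdjoinRoot.root k) = AdjoinRoot.root h := by simp [θ]
  have hdom : IsDomain (AdjoinRoot k) := AdjoinRoot.isDomain_of_prime hi.prime
  have hdeg : k.degree ≠ 0 := fun h0 => hi.not_isUnit (by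
    rw [hk.natDegree_eq_zero.mp (natDegree_eq_of_degree_eq_some h0)]; exact isUnit_one)
  have hch : CharZero (AdjoinRoot k) :=
    charZero_of_injective_ringHom (AdjoinRoot.of.injective_of_degree_ne_zero hdeg)
  obtain ⟨q, hq⟩ := hkd
  have hx : IsPrimitiveRoot (AdjoinRoot.root k) (p ^ e * m) := by
    rw [← isRoot_cyclotomic_iff_charZero hN, IsRoot.def, ← map_cyclotomic _ (AdjoinRoot.of k),
      eval_map, hq, eval₂_mul, AdjoinRoot.eval₂_root, zero_mul]
  have hle := aux_le p e m hm k hk hi hch hx h hirr hprim j hj hj0 θ hθ hθx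
  have hcop : Nat.Coprime (p ^ e * m - 1) (p ^ e * m) := by
    have := (Nat.coprime_self_add_right (m := p ^ e * m - 1) (n := 1)).mpr (Nat.coprime_one_right _)
    rwa [Nat.sub_add_cancel hN] at this
  have hyprim := hx.pow_of_coprime _ hcop
  have hxy : AdjoinRoot.root k ^ (p ^ e * m - 1) * AdjoinRoot.root k = 1 := by
    rw [← pow_succ, Nat.sub_add_cancel hN, hx.pow_eq_one]
  set y := AdjoinRoot.root k ^ (p ^ e * m - 1) with hy
  apply aux_symm_of_root p k hk y hxy
  have hky : eval₂ (AdjoinRoot.of k) y k * eval₂ (AdjoinRoot.of k) y q = 0 := by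
    rw [← eval₂_mul, ← hq, ← eval_map, map_cyclotomic]
    exact hyprim.isRoot_cyclotomic hN
  rcases mul_eq_zero.mp hky with h0 | h0
  · exact h0
  exfalso
  obtain ⟨r, hr⟩ := hr
  have hα0 : AdjoinRoot.root h ≠ 0 := hprim.ne_zero hm0
  have hθy : θ y = AdjoinRoot.root h ^ (p ^ r) := by
    have h1 := congrArg θ hxy
    rw [map_mul, hθx, map_one] at h1
    apply mul_right_cancel₀ hα0
    rw [h1, ← pow_succ]
    symm
    rw [hprim.pow_eq_one_iff_dvd, ← ZMod.natCast_eq_zero_iff]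
    push_cast
    rw [hr]; ring
  have h1 := congrArg θ h0
  rw [hom_eval₂, hθ, map_zero, hθy, ← eval₂_map] at h1
  have hchp : CharP (AdjoinRoot h) p :=
    charP_of_injective_algebraMap (algebraMap (ZMod p) _).injective p
  have hfr : ∀ s : (ZMod p)[X], eval₂ (AdjoinRoot.of h) (AdjoinRoot.root h ^ (p ^ r)) s
      = (eval₂ (AdjoinRoot.of h) (AdjoinRoot.root h) s) ^ (p ^ r) := by
    intro s
    have h2 : (iterateFrobenius (AdjoinRoot h) p r).comp (AdjoinRoot.of h) = AdjoinRoot.of h :=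
      Subsingleton.elim _ _
    rw [← iterateFrobenius_def, ← iterateFrobenius_def, hom_eval₂, h2]
  rw [hfr] at h1
  have h2 := eq_zero_of_pow_eq_zero h1
  have h3 : h ∣ q.map PadicInt.toZMod := by
    rw [← AdjoinRoot.mk_eq_zero, ← AdjoinRoot.aeval_eq, aeval_def]
    exact h2
  have h4 : h ^ (Nat.totient (p ^ e) + 1) ∣ cyclotomic m (ZMod p) ^ (Nat.totient (p ^ e)) := by
    rw [← aux_cyc p e m hm, ← aux_map_cyc, hq, Polynomial.map_mul, hj, pow_succ]
    exact mul_dvd_mul (pow_dvd_pow h hle) h3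
  have hmne : NeZero (m : ZMod p) := ⟨by rwa [Ne, ZMod.natCast_eq_zero_iff]⟩
  have hsq : Squarefree (cyclotomic m (ZMod p)) := squarefree_cyclotomic m (ZMod p)
  obtain ⟨c, hc⟩ := hdm
  rw [hc, mul_pow, pow_succ, mul_dvd_mul_iff_left (pow_ne_zero _ hirr.ne_zero)] at h4
  have h5 := hirr.prime.dvd_of_dvd_pow h4
  exact hirr.not_isUnit (hsq h (by rw [hc]; exact mul_dvd_mul_left h h5))

theorem aux_C (q n n' : ℕ) (h1 : 1 ≤ n') (hlt : n' < n)
    (hq : q ∈ PiSet (cyclotomic n ℤ) (cyclotomic n' ℤ)) :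
    q.Prime ∧ ∃ j a m : ℕ, 1 ≤ j ∧ n = q ^ j * n' ∧ n = q ^ a * m ∧ ¬ q ∣ m ∧
      ∃ r : ℕ, (q : ZMod m) ^ r = -1 := by
  obtain ⟨hF, h, ⟨hmon, hirr, k, hk, hi, hs, hkd, hd⟩, ⟨_, _, k', _, _, _, hkd', hd'⟩⟩ := hq
  have hp : q.Prime := hF.out
  refine ⟨hp, ?_⟩
  obtain ⟨a, m, hm, hn⟩ := Nat.exists_eq_pow_mul_and_not_dvd (n := n) (by omega) q hp.ne_one
  obtain ⟨b, m', hm', hn'⟩ := Nat.exists_eq_pow_mul_and_not_dvd (n := n') (by omega) q hp.ne_one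
  have hFi : Fact (Irreducible h) := ⟨hirr⟩
  have e1 : IsPrimitiveRoot (AdjoinRoot.root h) m := by
    apply aux_prim q a m hm
    rw [← hn, ← aux_map_cyc]
    rw [map_cyclotomic] at hkd
    exact hd.trans (Polynomial.map_dvd _ hkd)
  have e2 : IsPrimitiveRoot (AdjoinRoot.root h) m' := by
    apply aux_prim q b m' hm'
    rw [← hn', ← aux_map_cyc]
    rw [map_cyclotomic] at hkd'
    exact hd'.trans (Polynomial.map_dvd _ hkd')
  obtain rfl := e1.unique e2
  have hm0 : 0 < m := Nat.pos_of_ne_zero (by rintro rfl; simp at hm)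
  have hab : b < a := by
    rw [hn, hn'] at hlt
    exact (Nat.pow_lt_pow_iff_right hp.one_lt).mp (lt_of_mul_lt_mul_right hlt hm0.le)
  refine ⟨a - b, a, m, by omega, ?_, hn, hm, ?_⟩
  · rw [hn, hn', ← mul_assoc, ← pow_add, Nat.sub_add_cancel hab.le]
  · exact aux_A q a m hm k hk hi hs (hn ▸ hkd) h hmon hirr hd

theorem aux_unique (p e m a m' : ℕ) (hp : p.Prime) (hm : ¬ p ∣ m) (hm' : ¬ p ∣ m')
    (h : p ^ e * m = p ^ a * m') : m = m' := by
  have hc : ∀ {x y : ℕ} (c : ℕ), ¬ p ∣ x → x ∣ p ^ c * y → x ∣ y := fun c hx hd =>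
    (Nat.Coprime.pow_right c ((hp.coprime_iff_not_dvd.mpr hx).symm)).dvd_of_dvd_mul_left hd
  exact Nat.dvd_antisymm (hc a hm ⟨p ^ e, by rw [← h, mul_comm]⟩)
    (hc e hm' ⟨p ^ a, by rw [h, mul_comm]⟩)

theorem piSet_cyclotomic (n n' : ℕ) (h1 : 1 ≤ n') (hlt : n' < n) :
    ((¬ ∃ p k : ℕ, p.Prime ∧ 1 ≤ k ∧ n = p ^ k * n') →
      PiSet (Polynomial.cyclotomic n ℤ) (Polynomial.cyclotomic n' ℤ) = ∅) ∧
    (∀ p k : ℕ, p.Prime → 1 ≤ k → n = p ^ k * n' →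
      ∀ e m : ℕ, ¬ p ∣ m → n = p ^ e * m →
        ((∃ r : ℕ, (p : ZMod m) ^ r = -1) →
          PiSet (Polynomial.cyclotomic n ℤ) (Polynomial.cyclotomic n' ℤ) = {p}) ∧
        (¬ (∃ r : ℕ, (p : ZMod m) ^ r = -1) →
          PiSet (Polynomial.cyclotomic n ℤ) (Polynomial.cyclotomic n' ℤ) = ∅)) := by
  refine ⟨fun hno => ?_, fun p k hp hk hn e m hm hnm => ?_⟩
  · refine Set.eq_empty_iff_forall_notMem.mpr fun q hq => hno ?_
    obtain ⟨hqp, j, _, _, hj, hnj, _⟩ := aux_C q n n' h1 hlt hq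
    exact ⟨q, j, hqp, hj, hnj⟩
  have key : ∀ q, q ∈ PiSet (cyclotomic n ℤ) (cyclotomic n' ℤ) →
      q = p ∧ ∃ r : ℕ, (p : ZMod m) ^ r = -1 := by
    intro q hq
    obtain ⟨hqp, j, a, m', hj, hnj, hna, hm', hr⟩ := aux_C q n n' h1 hlt hq
    have hpow : q ^ j = p ^ k := by
      apply Nat.eq_of_mul_eq_mul_right h1
      rw [← hnj, ← hn]
    have hqeq : q = p := by
      have : q ∣ p ^ k := by rw [← hpow]; exact dvd_pow_self q (by omega)
      exact (Nat.prime_dvd_prime_iff_eq hqp hp).mp (hqp.dvd_of_dvd_pow this)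
    subst hqeq
    have := aux_unique q e m a m' hqp hm hm' (by rw [← hnm, ← hna])
    subst this
    exact ⟨rfl, hr⟩
  refine ⟨fun hr => ?_, fun hr => ?_⟩
  · refine Set.Subset.antisymm (fun q hq => (key q hq).1) ?_
    intro q hqp
    rw [Set.mem_singleton_iff] at hqp
    subst hqp
    have hF : Fact q.Prime := ⟨hp⟩
    refine ⟨hF, ?_⟩
    obtain ⟨b, m', hm', hn'⟩ := Nat.exists_eq_pow_mul_and_not_dvd (n := n') (by omega) q hp.ne_one
    have hmm : m = m' := aux_unique q e m (k + b) m' hp hm hm'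
      (by rw [← hnm, hn, hn', pow_add, mul_assoc])
    subst hmm
    have hm0 : 0 < m := Nat.pos_of_ne_zero (by rintro rfl; simp at hm)
    obtain ⟨h, hmon, hirr, hd⟩ := exists_monic_irreducible_factor (cyclotomic m (ZMod q))
      (fun hu => by
        have := natDegree_eq_zero_of_isUnit hu
        rw [natDegree_cyclotomic] at this
        exact (Nat.totient_pos.mpr hm0).ne' this)
    refine ⟨h, ?_, ?_⟩
    · rw [hnm]; exact aux_B q e m hm hr h hmon hirr hd
    · rw [hn']; exact aux_B q b m hm hr h hmon hirr hd
  · exact Set.eq_empty_iff_forall_notMem.mpr fun q hq => hr (key q hq).2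
end

section
/- Let f ∈ ℤ[X] be a monic *-symmetric polynomial with f(1)·f(−1) ≠ 0, and let p be a prime. (i) If the p-adic valuation of f(1) is odd, then X−1 ∈ Ī(f;ℚ_p). (ii) If the p-adic valuation of f(−1) is odd, then X+1 ∈ Ī(f;ℚ_p). (iii) If there is no u ∈ ℚ₂ˣ with (−1)^(deg f/2)·f(1)·f(−1) = u² and no u ∈ ℚ₂ˣ with (−1)^(deg f/2)·f(1)·f(−1) = −3·u², then X−1 ∈ Ī(f;ℚ₂). -/
open Polynomial

section helpers
set_option linter.unusedSectionVars false
variable {R : Type*} [CommRing R] [IsDomain R]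

theorem aux_natDegree_reverse (g : R[X]) (h0 : g.eval 0 ≠ 0) :
    g.reverse.natDegree = g.natDegree := by
  rw [reverse_natDegree, natTrailingDegree_eq_zero.2]
  · simp
  · right; rwa [coeff_zero_eq_eval_zero]

theorem aux_reverse_reverse (g : R[X]) (h0 : g.eval 0 ≠ 0) :
    g.reverse.reverse = g := by
  ext n
  rw [coeff_reverse, coeff_reverse, aux_natDegree_reverse g h0, revAt_invol]

theorem aux_leadingCoeff_reverse (g : R[X]) (h0 : g.eval 0 ≠ 0) :
    g.reverse.leadingCoeff = g.eval 0 := by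
  rw [leadingCoeff, aux_natDegree_reverse g h0, coeff_reverse, revAt_le le_rfl, Nat.sub_self,
    coeff_zero_eq_eval_zero]

theorem aux_star (g : R[X]) (hg : g.Monic) (hu : IsUnit (g.eval 0)) :
    ∃ g' : R[X], g'.Monic ∧ g.reverse = C (g.eval 0) * g' ∧ g'.natDegree = g.natDegree ∧
      g'.reverse = C (g'.eval 0) * g ∧ IsUnit (g'.eval 0) := by
  obtain ⟨u, hu'⟩ := hu
  have h0 : g.eval 0 ≠ 0 := by rw [← hu']; exact u.ne_zero
  have hCu : C (↑u : R) * C (↑u⁻¹ : R) = 1 := by rw [← C_mul]; simp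
  have hui : (↑u⁻¹ : R) ≠ 0 := u⁻¹.ne_zero
  have e0 : (C (↑u⁻¹ : R) * g.reverse).eval 0 = (↑u⁻¹ : R) := by
    rw [eval_mul, eval_C, ← coeff_zero_eq_eval_zero, coeff_zero_reverse, hg.leadingCoeff, mul_one]
  refine ⟨C (↑u⁻¹ : R) * g.reverse, ?_, ?_, ?_, ?_, ?_⟩
  · rw [Monic, leadingCoeff_mul, leadingCoeff_C, aux_leadingCoeff_reverse g h0, ← hu']; simp
  · rw [← hu', ← mul_assoc, hCu, one_mul]
  · rw [natDegree_C_mul hui, aux_natDegree_reverse g h0]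
  · rw [e0, reverse_mul_of_domain, reverse_C, aux_reverse_reverse g h0]
  · rw [e0]; exact u⁻¹.isUnit

theorem aux_cancel (A B : R[X]) (hA : A ≠ 0) (hu : A.eval 0 ≠ 0)
    (hs : A.reverse = C (A.eval 0) * A)
    (hAB : (A * B).reverse = C ((A * B).eval 0) * (A * B)) :
    B.reverse = C (B.eval 0) * B := by
  rw [reverse_mul_of_domain, hs, eval_mul, C_mul] at hAB
  have : C (A.eval 0) * A ≠ 0 := mul_ne_zero (by simpa using hu) hA
  apply mul_left_cancel₀ this
  rw [hAB]; ring

theorem aux_factor [UniqueFactorizationMonoid R] (F : R[X]) (hF : F.Monic) (h1 : F ≠ 1) :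
    ∃ g G : R[X], g.Monic ∧ Irreducible g ∧ G.Monic ∧ F = g * G := by
  obtain ⟨q, hq, hqF⟩ := WfDvdMonoid.exists_irreducible_factor
    (a := F) (by rwa [hF.isUnit_iff]) hF.ne_zero
  obtain ⟨u, hu⟩ := hF.isUnit_leadingCoeff_of_dvd hqF
  have hass : Associated q (C (↑u⁻¹ : R) * q) := by
    rw [mul_comm]
    exact (associated_mul_isUnit_right_iff (isUnit_C.2 u⁻¹.isUnit)).2 (Associated.refl _)
  have hm : (C (↑u⁻¹ : R) * q).Monic := by
    rw [Monic, leadingCoeff_mul, leadingCoeff_C, ← hu]; simp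
  obtain ⟨G, hG⟩ := hass.symm.dvd.trans hqF
  exact ⟨_, G, hm, hass.irreducible hq, hm.of_mul_monic_left (hG ▸ hF), hG⟩

theorem aux_induction [UniqueFactorizationMonoid R] (P : R[X] → Prop) (h1 : P 1)
    (hmul : ∀ a b, P a → P b → P (a * b)) (n : ℕ) : ∀ (F : R[X]), F.natDegree = n → F.Monic →
    F.reverse = C (F.eval 0) * F → IsUnit (F.eval 0) →
    (∀ k : R[X], k.Monic → Irreducible k → k.reverse = C (k.eval 0) * k → k ∣ F → P k) →
    (∀ g g' : R[X], g.Monic → g'.Monic → IsUnit (g.eval 0) → g'.natDegree = g.natDegree →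
      g.reverse = C (g.eval 0) * g' → g * g' ∣ F → P (g * g')) → P F := by
  induction n using Nat.strong_induction_on with
  | _ n ih =>
  intro F hn hF hs hu hk hg
  by_cases hF1 : F = 1
  · rwa [hF1]
  obtain ⟨g, G, hgm, hgi, hGm, hFgG⟩ := aux_factor F hF hF1
  have hgd : 0 < g.natDegree := by
    rw [hgm.natDegree_pos]; rintro rfl; exact hgi.not_isUnit isUnit_one
  have hu2 := hu
  rw [hFgG, eval_mul] at hu2
  have hgu := isUnit_of_mul_isUnit_left hu2
  have hGu := isUnit_of_mul_isUnit_right hu2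
  by_cases hgs : g.reverse = C (g.eval 0) * g
  · have hGs := aux_cancel g G hgm.ne_zero hgu.ne_zero hgs (hFgG ▸ hs)
    have hd : G.natDegree < n := by
      rw [← hn, hFgG, hgm.natDegree_mul hGm]; omega
    have hGF : G ∣ F := ⟨g, by rw [hFgG, mul_comm]⟩
    rw [hFgG]
    exact hmul _ _ (hk g hgm hgi hgs ⟨G, hFgG⟩) (ih _ hd G rfl hGm hGs hGu
      (fun k a b c d => hk k a b c (d.trans hGF))
      (fun g g' a b c d e f => hg g g' a b c d e (f.trans hGF)))
  · obtain ⟨g', hg'm, hg'r, hg'd, hg'r', hg'u⟩ := aux_star g hgm hgu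
    obtain ⟨G', hG'm, hG'r, hG'd, hG'r', hG'u⟩ := aux_star G hGm hGu
    have e1 : g' * G' = g * G := by
      have h := hs
      rw [hFgG, reverse_mul_of_domain, hg'r, hG'r, eval_mul, C_mul] at h
      have hne : C (g.eval 0) * C (G.eval 0) ≠ 0 :=
        mul_ne_zero (by simpa using hgu.ne_zero) (by simpa using hGu.ne_zero)
      apply mul_left_cancel₀ hne
      rw [← h]; ring
    have hdv : g ∣ g' * G' := ⟨G, e1⟩
    rcases hgi.prime.dvd_or_dvd hdv with h | ⟨H, hH⟩
    · exact absurd (by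
        rw [eq_of_monic_of_dvd_of_natDegree_le hgm hg'm h hg'd.le] at hg'r; exact hg'r) hgs
    · have hHm : H.Monic := hgm.of_mul_monic_left (hH ▸ hG'm)
      have hHu : IsUnit (H.eval 0) := by
        rw [hH, eval_mul] at hG'u; exact isUnit_of_mul_isUnit_right hG'u
      obtain ⟨H', hH'm, hH'r, hH'd, hH'r', hH'u⟩ := aux_star H hHm hHu
      have e2 : G = g' * H' := by
        have h := hG'r'
        rw [hH, reverse_mul_of_domain, hg'r, hH'r, eval_mul, C_mul] at h
        have hne : C (g.eval 0) * C (H.eval 0) ≠ 0 :=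
          mul_ne_zero (by simpa using hgu.ne_zero) (by simpa using hHu.ne_zero)
        apply mul_left_cancel₀ hne
        rw [← h]; ring
      have e3 : F = (g * g') * H' := by rw [hFgG, e2, mul_assoc]
      have hggm := hgm.mul hg'm
      have hggs : (g * g').reverse = C ((g * g').eval 0) * (g * g') := by
        rw [reverse_mul_of_domain, hg'r, hg'r', eval_mul, C_mul]; ring
      have hggu : (g * g').eval 0 ≠ 0 := by
        rw [eval_mul]; exact mul_ne_zero hgu.ne_zero hg'u.ne_zero
      have hH's := aux_cancel _ H' hggm.ne_zero hggu hggs (e3 ▸ hs)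
      have hd : H'.natDegree < n := by
        rw [← hn, e3, hggm.natDegree_mul hH'm, hgm.natDegree_mul hg'm]; omega
      have hHF : H' ∣ F := ⟨g * g', by rw [e3, mul_comm]⟩
      rw [e3]
      exact hmul _ _ (hg g g' hgm hg'm hgu hg'd hg'r ⟨H', e3⟩) (ih _ hd H' rfl hH'm hH's hH'u
        (fun k a b c d => hk k a b c (d.trans hHF))
        (fun g g' a b c d e f => hg g g' a b c d e (f.trans hHF)))

theorem aux_eval_reverse_one (g : R[X]) : g.reverse.eval 1 = g.eval 1 := by
  let _ : Invertible (1 : R) := invertibleOne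
  have h := eval₂_reverse_mul_pow (RingHom.id R) 1 g
  simpa [eval₂_id] using h

theorem aux_eval_reverse_neg_one (g : R[X]) :
    g.reverse.eval (-1) = (-1) ^ g.natDegree * g.eval (-1) := by
  let _ : Invertible (-1 : R) := ⟨-1, by ring, by ring⟩
  have h := eval₂_reverse_mul_pow (RingHom.id R) (-1) g
  change eval₂ (RingHom.id R) (-1) (reverse g) * _ = _ at h
  simp only [eval₂_id] at h
  rw [← h, mul_comm, mul_assoc, ← mul_pow]; simp

/-- A symmetric polynomial not vanishing at `±1` has constant term `1` and even degree. -/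
theorem aux_sym (h2 : (2 : R) ≠ 0) (k : R[X])
    (hs : k.reverse = C (k.eval 0) * k) (h1 : k.eval 1 ≠ 0)
    (h1' : k.eval (-1) ≠ 0) : k.eval 0 = 1 ∧ Even k.natDegree := by
  have e1 : k.eval 0 = 1 := by
    have h := aux_eval_reverse_one k
    rw [hs, eval_mul, eval_C] at h
    exact mul_right_cancel₀ h1 (by rw [h, one_mul])
  refine ⟨e1, ?_⟩
  have h := aux_eval_reverse_neg_one k
  rw [hs, e1, C_1, one_mul] at h
  by_contra ho
  rw [(Nat.not_even_iff_odd.1 ho).neg_one_pow] at h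
  have : 2 * k.eval (-1) = 0 := by linear_combination h
  exact (mul_ne_zero h2 h1') this

theorem aux_mod_four (k : R[X]) (n : ℕ) (hd : k.natDegree = n + n)
    (hs : k.reverse = k) : ∃ t : R, k.eval 1 - (-1) ^ n * k.eval (-1) = 4 * t := by
  have hc : ∀ i, i ≤ n + n → k.coeff (n + n - i) = k.coeff i := by
    intro i hi
    conv_rhs => rw [← hs, coeff_reverse, hd, revAt_le hi]
  have hsum : k.eval 1 - (-1) ^ n * k.eval (-1) =
      ∑ i ∈ Finset.range (n + n + 1), k.coeff i * (1 - (-1) ^ (n + i)) := by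
    rw [eval_eq_sum_range, eval_eq_sum_range, hd, Finset.mul_sum, ← Finset.sum_sub_distrib]
    refine Finset.sum_congr rfl fun i _ => ?_
    rw [pow_add]; ring
  have hpar : ∀ m : ℕ, ∃ s : R, (1 - (-1) ^ m : R) = 2 * s := by
    intro m
    rcases neg_one_pow_eq_or R m with h | h <;> rw [h]
    · exact ⟨0, by ring⟩
    · exact ⟨1, by ring⟩
  choose s hs' using hpar
  refine ⟨∑ i ∈ Finset.range n, k.coeff i * s (n + i), ?_⟩
  rw [hsum, show n + n + 1 = n + 1 + n by ring, Finset.sum_range_add, Finset.sum_range_succ]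
  have hmid : (1 - (-1) ^ (n + n) : R) = 0 := by
    rw [← two_mul, pow_mul]; simp
  rw [hmid, mul_zero, add_zero]
  have : ∑ x ∈ Finset.range n, k.coeff (n + 1 + x) * (1 - (-1) ^ (n + (n + 1 + x))) =
      ∑ i ∈ Finset.range n, k.coeff i * (1 - (-1 : R) ^ (n + i)) := by
    rw [← Finset.sum_range_reflect]
    refine Finset.sum_congr rfl fun i hi => ?_
    have hi := Finset.mem_range.1 hi
    rw [show n + 1 + (n - 1 - i) = n + n - i by omega, hc i (by omega)]
    have h3 : (-1 : R) ^ (n + (n + n - i)) * (-1) ^ (n + i) = 1 := by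
      rw [← pow_add, show n + (n + n - i) + (n + i) = 2 * (2 * n) by omega, pow_mul]; simp
    have h4 : (-1 : R) ^ (n + (n + n - i)) = (-1) ^ (n + i) := by
      rcases neg_one_pow_eq_or R (n + i) with h | h <;> rw [h] at h3 ⊢
      · linear_combination h3
      · linear_combination -h3
    rw [h4]
  rw [this, ← two_mul, Finset.mul_sum, Finset.mul_sum]
  refine Finset.sum_congr rfl fun i _ => ?_
  rw [hs']; ring
end helpers

section padic
variable {p : ℕ} [Fact p.Prime]

theorem aux_toZMod_eq_zero (x : ℤ_[p]) : PadicInt.toZMod x = 0 ↔ ¬ IsUnit x := by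
  rw [← RingHom.mem_ker, PadicInt.ker_toZMod, IsLocalRing.mem_maximalIdeal, mem_nonunits_iff]

theorem aux_dvd_map (k : ℤ_[p][X]) (e : ℤ) (h : ¬ IsUnit (k.eval (e : ℤ_[p]))) :
    (X - C (e : ZMod p)) ∣ k.map (PadicInt.toZMod : ℤ_[p] →+* ZMod p) := by
  rw [dvd_iff_isRoot, IsRoot.def]
  have h2 := (aux_toZMod_eq_zero _).2 h
  rw [← h2, ← eval_map_apply]
  simp

theorem aux_unit_of_notMem (f : ℤ[X]) (e : ℤ) (h : X - C (e : ZMod p) ∉ IbarSet p f)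
    (k : ℤ_[p][X]) (hm : k.Monic) (hi : Irreducible k) (hs : k.reverse = C (k.eval 0) * k)
    (hd : k ∣ f.map (Int.castRingHom ℤ_[p])) : IsUnit (k.eval (e : ℤ_[p])) := by
  by_contra hu
  exact h ⟨monic_X_sub_C _, irreducible_X_sub_C _, k, hm, hi, hs, hd, aux_dvd_map k e hu⟩

theorem aux_map (f : ℤ[X]) (hmonic : f.Monic) (hsymm : f.reverse = C (f.eval 0) * f)
    (hne : f.eval 1 * f.eval (-1) ≠ 0) :
    (f.map (Int.castRingHom ℤ_[p])).Monic ∧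
    (f.map (Int.castRingHom ℤ_[p])).reverse =
      C ((f.map (Int.castRingHom ℤ_[p])).eval 0) * f.map (Int.castRingHom ℤ_[p]) ∧
    IsUnit ((f.map (Int.castRingHom ℤ_[p])).eval 0) := by
  have h0 := (aux_sym (by norm_num) f hsymm (left_ne_zero_of_mul hne)
    (right_ne_zero_of_mul hne)).1
  have e0 : (f.map (Int.castRingHom ℤ_[p])).eval 0 = 1 := by
    rw [← coeff_zero_eq_eval_zero, coeff_map, coeff_zero_eq_eval_zero, h0, map_one]
  refine ⟨hmonic.map _, ?_, by rw [e0]; exact isUnit_one⟩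
  rw [e0, C_1, one_mul]
  rw [h0, C_1, one_mul] at hsymm
  ext n
  rw [coeff_reverse, hmonic.natDegree_map, coeff_map, ← coeff_reverse, hsymm, coeff_map]

theorem aux_pair_eval (g g' : ℤ_[p][X]) (hr : g.reverse = C (g.eval 0) * g') :
    g.eval 0 * g'.eval 1 = g.eval 1 ∧
    g.eval 0 * g'.eval (-1) = (-1) ^ g.natDegree * g.eval (-1) := by
  rw [← aux_eval_reverse_one g, ← aux_eval_reverse_neg_one g, hr]
  simp

theorem aux_part_eval (f : ℤ[X]) (hmonic : f.Monic) (hsymm : f.reverse = C (f.eval 0) * f)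
    (hne : f.eval 1 * f.eval (-1) ≠ 0) (e : ℤ) (he : e = 1 ∨ e = -1)
    (hodd : Odd (padicValInt p (f.eval e))) : X - C (e : ZMod p) ∈ IbarSet p f := by
  by_contra hmem
  obtain ⟨hm, hs, hu⟩ := aux_map (p := p) f hmonic hsymm hne
  have key : ∃ u v : ℤ_[p], IsUnit u ∧
      (f.map (Int.castRingHom ℤ_[p])).eval (e : ℤ_[p]) = u * v ^ 2 := by
    refine aux_induction
      (P := fun a : ℤ_[p][X] => ∃ u v : ℤ_[p], IsUnit u ∧ a.eval (e : ℤ_[p]) = u * v ^ 2)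
      ⟨1, 1, isUnit_one, by simp⟩ ?_ _ _ rfl hm hs hu ?_ ?_
    · rintro a b ⟨u, v, hu, h⟩ ⟨u', v', hu', h'⟩
      exact ⟨u * u', v * v', hu.mul hu', by rw [eval_mul, h, h']; ring⟩
    · intro k km ki ks kd
      exact ⟨_, 1, aux_unit_of_notMem f e hmem k km ki ks kd, by simp⟩
    · rintro g g' - - hgu - hr -
      obtain ⟨w, hw⟩ := hgu.exists_left_inv
      obtain ⟨h1, h2⟩ := aux_pair_eval g g' hr
      have hwu : IsUnit w := IsUnit.of_mul_eq_one _ hw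
      rcases he with rfl | rfl
      · refine ⟨w, g.eval 1, hwu, ?_⟩
        simp only [eval_mul, Int.cast_one]
        linear_combination (-g.eval 1 * g'.eval 1) * hw + w * g.eval 1 * h1
      · refine ⟨w * (-1) ^ g.natDegree, g.eval (-1), hwu.mul (isUnit_one.neg.pow _), ?_⟩
        simp only [eval_mul, Int.cast_neg, Int.cast_one]
        linear_combination (-g.eval (-1) * g'.eval (-1)) * hw + w * g.eval (-1) * h2
  obtain ⟨u, v, hu, h⟩ := key
  have hE : (f.map (Int.castRingHom ℤ_[p])).eval (e : ℤ_[p]) = ((f.eval e : ℤ) : ℤ_[p]) := by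
    rw [eval_intCast_map]; simp
  rw [hE] at h
  have hfe : f.eval e ≠ 0 := by
    rcases he with rfl | rfl
    · exact left_ne_zero_of_mul hne
    · exact right_ne_zero_of_mul hne
  have hv : v ≠ 0 := by
    rintro rfl
    apply hfe
    have : ((f.eval e : ℤ) : ℤ_[p]) = 0 := by rw [h]; simp
    exact_mod_cast this
  have hval : ((f.eval e : ℤ) : ℤ_[p]).valuation = padicValInt p (f.eval e) := by
    zify
    rw [← PadicInt.valuation_coe, PadicInt.coe_intCast, Padic.valuation_intCast]
  have hvu : u.valuation = 0 := by
    obtain ⟨w, hw⟩ := hu.exists_right_inv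
    have hw0 : w ≠ 0 := by rintro rfl; simp at hw
    have := PadicInt.valuation_mul hu.ne_zero hw0
    rw [hw, PadicInt.valuation_one] at this
    omega
  rw [← hval, h, PadicInt.valuation_mul hu.ne_zero (pow_ne_zero _ hv), hvu,
    PadicInt.valuation_pow, zero_add] at hodd
  exact (Nat.not_odd_iff_even.2 (even_two_mul _)) hodd

end padic

theorem aux_hensel_s14 (s : ℤ_[2]) (hs : ¬ IsUnit s) : ∃ z : ℤ_[2], 1 + 4 * s = z ^ 2 := by
  have hn : ‖s‖ < 1 := by
    rwa [← PadicInt.mem_nonunits, mem_nonunits_iff]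
  obtain ⟨z, hz, -⟩ := hensels_lemma (p := 2) (F := (X ^ 2 + X - C s : ℤ_[2][X])) (a := (0 : ℤ_[2]))
    (by simpa using hn)
  refine ⟨1 + 2 * z, ?_⟩
  simp at hz
  linear_combination 4 * -hz

theorem aux_unit_class (t : ℤ_[2]) :
    (∃ z : ℤ_[2], 1 + 4 * t = z ^ 2) ∨ (∃ z : ℤ_[2], 1 + 4 * t = -3 * z ^ 2) := by
  by_cases ht : IsUnit t
  · right
    have h3 : IsUnit (3 : ℤ_[2]) := by
      by_contra h
      rw [← aux_toZMod_eq_zero, map_ofNat] at h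
      exact absurd h (by decide)
    obtain ⟨i, hi⟩ := h3.exists_right_inv
    have h1 : ¬ IsUnit (-(1 + t) * i) := by
      rw [← aux_toZMod_eq_zero, map_mul, map_neg, map_add, map_one]
      have : (PadicInt.toZMod t : ZMod 2) ≠ 0 := by
        rw [Ne, aux_toZMod_eq_zero, not_not]; exact ht
      have h2 : ∀ x : ZMod 2, x ≠ 0 → 1 + x = 0 := by decide
      rw [h2 _ this]; simp
    obtain ⟨z, hz⟩ := aux_hensel_s14 _ h1
    refine ⟨z, ?_⟩
    rw [← hz]
    linear_combination (-4 * (1 + t)) * hi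
  · left; exact aux_hensel_s14 t ht

theorem aux_part_three (f : ℤ[X]) (hmonic : f.Monic) (hsymm : f.reverse = C (f.eval 0) * f)
    (hne : f.eval 1 * f.eval (-1) ≠ 0) (hmem : X - C ((1 : ℤ) : ZMod 2) ∉ IbarSet 2 f) :
    ∃ t v : ℤ_[2],
      (((-1) ^ (f.natDegree / 2) * f.eval 1 * f.eval (-1) : ℤ) : ℤ_[2]) = (1 + 4 * t) * v ^ 2 := by
  obtain ⟨hm, hs, hu⟩ := aux_map (p := 2) f hmonic hsymm hne
  have hE1 : (f.map (Int.castRingHom ℤ_[2])).eval 1 = ((f.eval 1 : ℤ) : ℤ_[2]) := by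
    have := eval_intCast_map (Int.castRingHom ℤ_[2]) f 1
    simpa using this
  have hE2 : (f.map (Int.castRingHom ℤ_[2])).eval (-1) = ((f.eval (-1) : ℤ) : ℤ_[2]) := by
    have := eval_intCast_map (Int.castRingHom ℤ_[2]) f (-1)
    simpa using this
  have key : (f.map (Int.castRingHom ℤ_[2])).Monic ∧ ∃ (m : ℕ) (t v : ℤ_[2]),
      (f.map (Int.castRingHom ℤ_[2])).natDegree = m + m ∧
      (-1) ^ m * (f.map (Int.castRingHom ℤ_[2])).eval 1 *
        (f.map (Int.castRingHom ℤ_[2])).eval (-1) = (1 + 4 * t) * v ^ 2 := by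
    refine aux_induction
      (P := fun a : ℤ_[2][X] => a.Monic ∧ ∃ (m : ℕ) (t v : ℤ_[2]), a.natDegree = m + m ∧
        (-1) ^ m * a.eval 1 * a.eval (-1) = (1 + 4 * t) * v ^ 2)
      ⟨monic_one, 0, 0, 1, by simp, by simp⟩ ?_ _ _ rfl hm hs hu ?_ ?_
    · rintro a b ⟨ha, m, t, v, hd, h⟩ ⟨hb, m', t', v', hd', h'⟩
      refine ⟨ha.mul hb, m + m', t + t' + 4 * t * t', v * v', ?_, ?_⟩
      · rw [ha.natDegree_mul hb, hd, hd']; ring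
      · rw [eval_mul, eval_mul, pow_add]
        linear_combination ((-1) ^ m' * b.eval 1 * b.eval (-1)) * h + (1 + 4 * t) * v ^ 2 * h'
    · intro k km ki ks kd
      obtain ⟨w, hw⟩ := (aux_unit_of_notMem f 1 hmem k km ki ks kd).exists_right_inv
      rw [Int.cast_one] at hw
      have hk1 : k.eval 1 ≠ 0 := by intro h; rw [h] at hw; simp at hw
      have hk2 : k.eval (-1) ≠ 0 := by
        intro h
        obtain ⟨q, hq⟩ := kd
        rw [hq, eval_mul, h, zero_mul] at hE2
        apply right_ne_zero_of_mul hne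
        exact_mod_cast hE2.symm
      obtain ⟨h0, m, hd⟩ := aux_sym (by norm_num) k ks hk1 hk2
      rw [h0, C_1, one_mul] at ks
      obtain ⟨t, ht⟩ := aux_mod_four k m hd ks
      refine ⟨km, m, -t * w, k.eval 1, hd, ?_⟩
      linear_combination (-k.eval 1) * ht + 4 * t * k.eval 1 * hw
    · rintro g g' gm gm' hgu hd hr -
      obtain ⟨w, hw⟩ := hgu.exists_left_inv
      obtain ⟨h1, h2⟩ := aux_pair_eval g g' hr
      refine ⟨gm.mul gm', g.natDegree, 0, w * g.eval 1 * g.eval (-1), ?_, ?_⟩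
      · rw [gm.natDegree_mul gm', hd]
      · have h3 : g'.eval 1 = w * g.eval 1 := by
          linear_combination (-g'.eval 1) * hw + w * h1
        have h4 : g'.eval (-1) = w * ((-1) ^ g.natDegree * g.eval (-1)) := by
          linear_combination (-g'.eval (-1)) * hw + w * h2
        have h5 : ((-1 : ℤ_[2]) ^ g.natDegree) * (-1) ^ g.natDegree = 1 := by
          rw [← mul_pow]; simp
        rw [eval_mul, eval_mul, h3, h4]
        linear_combination (w * g.eval 1 * g.eval (-1)) ^ 2 * h5
  obtain ⟨-, m, t, v, hd, h⟩ := key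
  rw [hmonic.natDegree_map] at hd
  refine ⟨t, v, ?_⟩
  rw [← h, hE1, hE2, show f.natDegree / 2 = m by omega]
  push_cast
  ring

/-- Let `f ∈ ℤ[X]` be monic `*`-symmetric with `f(1)·f(-1) ≠ 0` and `p` a prime.
(i) If `v_p(f(1))` is odd then `X-1 ∈ Ī(f;ℚ_p)`; (ii) if `v_p(f(-1))` is odd then
`X+1 ∈ Ī(f;ℚ_p)`; (iii) if `(-1)^(deg f/2)·f(1)·f(-1)` is neither a square nor `-3`
times a square in `ℚ₂ˣ`, then `X-1 ∈ Ī(f;ℚ₂)`. -/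
theorem mem_ibarSet_of_nonsquare (f : Polynomial ℤ) (hmonic : f.Monic)
    (hsymm : f.reverse = Polynomial.C (f.eval 0) * f)
    (hne : f.eval 1 * f.eval (-1) ≠ 0)
    (p : ℕ) [Fact p.Prime] :
    (Odd (padicValInt p (f.eval 1)) → (X - 1 : Polynomial (ZMod p)) ∈ IbarSet p f) ∧
    (Odd (padicValInt p (f.eval (-1))) → (X + 1 : Polynomial (ZMod p)) ∈ IbarSet p f) ∧
    ((¬ ∃ u : ℚ_[2], u ≠ 0 ∧
        (((-1) ^ (f.natDegree / 2) * f.eval 1 * f.eval (-1) : ℤ) : ℚ_[2]) = u ^ 2) →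
     (¬ ∃ u : ℚ_[2], u ≠ 0 ∧
        (((-1) ^ (f.natDegree / 2) * f.eval 1 * f.eval (-1) : ℤ) : ℚ_[2]) = -3 * u ^ 2) →
     (X - 1 : Polynomial (ZMod 2)) ∈ IbarSet 2 f) := by
  refine ⟨fun h => ?_, fun h => ?_, fun h1 h2 => ?_⟩
  · have := aux_part_eval (p := p) f hmonic hsymm hne 1 (Or.inl rfl) h
    simpa using this
  · have := aux_part_eval (p := p) f hmonic hsymm hne (-1) (Or.inr rfl) h
    simpa using this
  · by_contra hmem
    obtain ⟨t, v, h⟩ := aux_part_three f hmonic hsymm hne (by simpa using hmem)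
    have hD : ((-1) ^ (f.natDegree / 2) * f.eval 1 * f.eval (-1) : ℤ) ≠ 0 := by
      rw [mul_assoc]
      exact mul_ne_zero (pow_ne_zero _ (by norm_num)) hne
    have hD' : (((-1) ^ (f.natDegree / 2) * f.eval 1 * f.eval (-1) : ℤ) : ℤ_[2]) ≠ 0 :=
      Int.cast_ne_zero.2 hD
    rcases aux_unit_class t with ⟨z, hz⟩ | ⟨z, hz⟩
    · rw [hz] at h
      refine h1 ⟨((z * v : ℤ_[2]) : ℚ_[2]), ?_, ?_⟩
      · intro h0
        have h0' : z * v = 0 := PadicInt.coe_eq_zero.1 h0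
        exact hD' (by rw [h, ← mul_pow, h0']; simp)
      · rw [← PadicInt.coe_intCast, h]; push_cast; ring
    · rw [hz] at h
      refine h2 ⟨((z * v : ℤ_[2]) : ℚ_[2]), ?_, ?_⟩
      · intro h0
        have h0' : z * v = 0 := PadicInt.coe_eq_zero.1 h0
        exact hD' (by rw [h, mul_assoc, ← mul_pow, h0']; simp)
      · rw [← PadicInt.coe_intCast, h]
        have h3 : ((3 : ℤ_[2]) : ℚ_[2]) = 3 := by
          have := PadicInt.coe_natCast (p := 2) 3
          exact_mod_cast this
        push_cast
        rw [h3]; ring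
end
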